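/- arXiv:1607.00517 — 4 statements merged into one kernel-verified Lean document; each statement's English description precedes it below -/
import Mathlib

section
/- Let X be a compact Hausdorff space that is the union of countably many countably tight subspaces. Then every pairwise disjoint collection of dense ω-bounded subspaces of X is countable. -/
open Set

/-- A topological space `Z` is countably tight if whenever a point lies in the closure
of a set `A`, it lies in the closure of a countable subset of `A`. -/
def CountablyTight (Z : Type*) [TopologicalSpace Z] : Prop :=
  ∀ (A : Set Z) (z : Z), z ∈ closure A → ∃ B ⊆ A, B.Countable ∧ z ∈ closure B

/-- A subset `D` of a space `X` is ω-bounded if every countable subset of `D`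
has compact closure contained in `D`. -/
def OmegaBounded {X : Type*} [TopologicalSpace X] (D : Set X) : Prop :=
  ∀ C ⊆ D, C.Countable → IsCompact (closure C) ∧ closure C ⊆ D

/-- A nonempty closed Gδ subset of a topological space. -/
def IsNonemptyClosedGδ {X : Type*} [TopologicalSpace X] (H : Set X) : Prop :=
  H.Nonempty ∧ IsClosed H ∧ IsGδ H

/-- The trace of an ω-bounded set on a countably tight subspace is relatively closed. -/
theorem OmegaBounded.mem_of_mem_closure_inter {X : Type*} [TopologicalSpace X] {A D : Set X}
    (hD : OmegaBounded D) (hA : CountablyTight ↥A) {x : X} (hxA : x ∈ A)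
    (hx : x ∈ closure (A ∩ D)) : x ∈ D := by
  have hx' : (⟨x, hxA⟩ : A) ∈ closure ((↑) ⁻¹' D : Set A) := by
    rw [closure_subtype, Subtype.image_preimage_coe]
    exact hx
  obtain ⟨B, hBD, hBc, hxB⟩ := hA _ _ hx'
  rw [closure_subtype] at hxB
  exact (hD _ (image_subset_iff.2 hBD) (hBc.image _)).2 hxB

/-- In a compact Hausdorff space, a dense ω-bounded set meets every nonempty closed Gδ set. -/
theorem OmegaBounded.inter_nonempty {X : Type*} [TopologicalSpace X] [CompactSpace X] [T2Space X]
    {D H : Set X} (hD : OmegaBounded D) (hdense : Dense D) (hH : IsNonemptyClosedGδ H) :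
    (D ∩ H).Nonempty := by
  obtain ⟨⟨h, hh⟩, hcl, hGδ⟩ := hH
  obtain ⟨U, hUo, rfl⟩ := isGδ_iff_eq_iInter_nat.1 hGδ
  have hW : ∀ n, ∃ W, IsOpen W ∧ (⋂ n, U n) ⊆ W ∧ closure W ⊆ U n := fun n =>
    normal_exists_closure_subset hcl (hUo n) (iInter_subset U n)
  choose W hWo hHW hWU using hW
  have hx : ∀ n : ℕ, ∃ x ∈ D, ∀ i ≤ n, x ∈ W i := by
    intro n
    have hopen : IsOpen (⋂ i ∈ Iic n, W i) :=
      (finite_Iic n).isOpen_biInter fun i _ => hWo i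
    obtain ⟨x, hx, hxD⟩ := hdense.inter_open_nonempty _ hopen
      ⟨h, mem_iInter₂.2 fun i _ => hHW i hh⟩
    exact ⟨x, hxD, fun i hi => mem_iInter₂.1 hx i hi⟩
  choose x hxD hxW using hx
  obtain ⟨y, hy⟩ := IsCompact.nonempty_iInter_of_sequence_nonempty_isCompact_isClosed
    (fun n => closure (x '' Ici n))
    (fun n => closure_mono (image_mono (Ici_subset_Ici.2 n.le_succ)))
    (fun n => (nonempty_Ici.image x).closure) isClosed_closure.isCompact
    (fun n => isClosed_closure)
  rw [mem_iInter] at hy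
  refine ⟨y, (hD (range x) (range_subset_iff.2 hxD) (countable_range x)).2
    (closure_mono (image_subset_range _ _) (hy 0)), mem_iInter.2 fun n => hWU n ?_⟩
  refine closure_mono ?_ (hy n)
  rintro _ ⟨k, hk, rfl⟩
  exact hxW k n hk

/-- In a compact Hausdorff space, a point of a closed Gδ set `H` outside the closure of `S`
yields a nonempty closed Gδ subset of `H` missing `S`. -/
theorem IsNonemptyClosedGδ.exists_subset_disjoint {X : Type*} [TopologicalSpace X]
    [CompactSpace X] [T2Space X] {H S : Set X} (hH : IsNonemptyClosedGδ H) {x : X}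
    (hxH : x ∈ H) (hxS : x ∉ closure S) :
    ∃ K ⊆ H, IsNonemptyClosedGδ K ∧ Disjoint S K := by
  obtain ⟨f, hf0, hf1, -⟩ := exists_continuous_zero_one_of_isClosed
    (isClosed_singleton (x := x)) (isClosed_closure (s := S)) (disjoint_singleton_left.2 hxS)
  have hcl : IsClosed (f ⁻¹' {0}) := isClosed_singleton.preimage f.continuous
  have hGδ : IsGδ (f ⁻¹' {0}) := (isClosed_singleton.isGδ).preimage f.continuous
  refine ⟨H ∩ f ⁻¹' {0}, inter_subset_left, ⟨⟨x, hxH, hf0 rfl⟩, hH.2.1.inter hcl,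
    hH.2.2.inter hGδ⟩, disjoint_left.2 fun y hyS hy => ?_⟩
  have h0 : f y = 0 := hy.2
  have h1 : f y = 1 := hf1 (subset_closure hyS)
  exact zero_ne_one (h0.symm.trans h1)

/-- In a compact space, countably many hereditary properties, each of which can be attained by
shrinking a nonempty closed Gδ set, can be attained simultaneously. -/
theorem IsNonemptyClosedGδ.exists_subset_forall {X : Type*} [TopologicalSpace X]
    [CompactSpace X] (P : ℕ → Set X → Prop)
    (hmono : ∀ n H K, K ⊆ H → P n H → P n K)
    {H : Set X} (hH : IsNonemptyClosedGδ H)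
    (hP : ∀ n, ∀ H' ⊆ H, IsNonemptyClosedGδ H' → ∃ K ⊆ H', IsNonemptyClosedGδ K ∧ P n K) :
    ∃ K ⊆ H, IsNonemptyClosedGδ K ∧ ∀ n, P n K := by
  have hP' : ∀ n (L : {L : Set X // L ⊆ H ∧ IsNonemptyClosedGδ L}),
      ∃ K : {L : Set X // L ⊆ H ∧ IsNonemptyClosedGδ L}, K.1 ⊆ L.1 ∧ P n K.1 := by
    rintro n ⟨L, hLH, hL⟩
    obtain ⟨K, hKL, hK, hPK⟩ := hP n L hLH hL
    exact ⟨⟨K, hKL.trans hLH, hK⟩, hKL, hPK⟩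
  choose g hg hPg using hP'
  let s : ℕ → {L : Set X // L ⊆ H ∧ IsNonemptyClosedGδ L} := fun n =>
    Nat.rec ⟨H, subset_rfl, hH⟩ (fun n L => g n L) n
  refine ⟨⋂ n, (s n).1, iInter_subset _ 0, ⟨?_, isClosed_iInter fun n => (s n).2.2.2.1,
    IsGδ.iInter fun n => (s n).2.2.2.2⟩, fun n => hmono n _ _ (iInter_subset _ (n + 1)) ?_⟩
  · exact IsCompact.nonempty_iInter_of_sequence_nonempty_isCompact_isClosed
      (fun n => (s n).1) (fun n => hg n (s n)) (fun n => (s n).2.2.1)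
      (s 0).2.2.2.1.isCompact (fun n => (s n).2.2.2.1)
  · exact hPg n (s n)

theorem stmt_2 {X : Type*} [TopologicalSpace X] [CompactSpace X] [T2Space X]
    (A : ℕ → Set X) (hct : ∀ n, CountablyTight ↥(A n)) (hcover : ⋃ n, A n = univ)
    (𝒟 : Set (Set X)) (hdense : ∀ D ∈ 𝒟, Dense D) (hwb : ∀ D ∈ 𝒟, OmegaBounded D)
    (hdisj : ∀ D₁ ∈ 𝒟, ∀ D₂ ∈ 𝒟, D₁ ≠ D₂ → D₁ ∩ D₂ = ∅) :
    𝒟.Countable := by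
  rcases isEmpty_or_nonempty X with hX | hX
  · exact (subsingleton_of_subsingleton (s := 𝒟)).countable
  let small : ℕ → Set X → Prop := fun n H => ∃ D ∈ 𝒟, A n ∩ H ⊆ D
  let avoidable : ℕ → Set X → Prop := fun n H => ∀ D ∈ 𝒟, ∀ H' ⊆ H, IsNonemptyClosedGδ H' →
    ∃ K ⊆ H', IsNonemptyClosedGδ K ∧ Disjoint (A n ∩ D) K
  obtain ⟨H, -, hH, hHP⟩ := IsNonemptyClosedGδ.exists_subset_forall
    (fun n H => small n H ∨ avoidable n H) (by
      rintro n H K hKH (⟨D, hD, hsub⟩ | h)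
      · exact Or.inl ⟨D, hD, (inter_subset_inter_right _ hKH).trans hsub⟩
      · exact Or.inr fun D hD H' hH' => h D hD H' (hH'.trans hKH))
    (⟨univ_nonempty, isClosed_univ, IsGδ.univ⟩ : IsNonemptyClosedGδ (univ : Set X)) (by
      intro n H _ hH
      by_cases h : ∃ K ⊆ H, IsNonemptyClosedGδ K ∧ small n K
      · obtain ⟨K, hKH, hK, hs⟩ := h
        exact ⟨K, hKH, hK, Or.inl hs⟩
      refine ⟨H, subset_rfl, hH, Or.inr fun D hD H' hH'H hH' => ?_⟩
      have hns : ¬ A n ∩ H' ⊆ D := fun hs => h ⟨H', hH'H, hH', D, hD, hs⟩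
      obtain ⟨x, ⟨hxA, hxH'⟩, hxD⟩ := not_subset.1 hns
      exact hH'.exists_subset_disjoint hxH' fun hx =>
        hxD ((hwb D hD).mem_of_mem_closure_inter (hct n) hxA hx))
  have hchoice : ∀ n, ∃ D, (D ∈ 𝒟 ∧ A n ∩ H ⊆ D) ∨ avoidable n H := by
    intro n
    rcases hHP n with ⟨D, hD⟩ | h
    · exact ⟨D, Or.inl hD⟩
    · exact ⟨∅, Or.inr h⟩
  choose E hE using hchoice
  refine (countable_range E).mono fun D hD => ?_
  by_contra hDE
  obtain ⟨K, -, hK, hdis⟩ := hH.exists_subset_forall (fun n K => Disjoint (A n ∩ D) K)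
    (fun n _ _ hsub h => h.mono_right hsub) (by
      intro n H' hH'H hH'
      rcases hE n with ⟨hEn, hsub⟩ | h
      · refine ⟨H', subset_rfl, hH', disjoint_left.2 fun x hx hxH' => ?_⟩
        have hne : D ≠ E n := fun h => hDE ⟨n, h.symm⟩
        exact (hdisj D hD (E n) hEn hne).subset ⟨hx.2, hsub ⟨hx.1, hH'H hxH'⟩⟩
      · exact h D hD H' hH'H hH')
  obtain ⟨x, hxD, hxK⟩ := (hwb D hD).inter_nonempty (hdense D hD) hK
  obtain ⟨n, hn⟩ := mem_iUnion.1 (hcover.symm ▸ mem_univ x)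
  exact disjoint_left.1 (hdis n) ⟨hn, hxD⟩ hxK
end

section
/- Let X be a compact Hausdorff space that is the union of countably many countably tight subspaces. Then every nonempty closed subspace Y of X contains a point y with countable π-character in Y, i.e., there is a countable family of nonempty open subsets of Y such that every neighborhood of y in Y contains a member of the family. -/
open Set

/-- Countable tightness passes to the domain of an inducing map. -/
theorem CountablyTight.of_isInducing {W Z : Type*} [TopologicalSpace W] [TopologicalSpace Z]
    {f : W → Z} (hf : Topology.IsInducing f) (h : CountablyTight Z) : CountablyTight W := by
  intro S z hz
  rw [hf.closure_eq_preimage_closure_image] at hz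
  obtain ⟨B, hBS, hB, hzB⟩ := h _ _ hz
  choose g hgS hg using fun b : B => hBS b.2
  have := hB.to_subtype
  refine ⟨range g, range_subset_iff.2 hgS, countable_range g, ?_⟩
  rw [hf.closure_eq_preimage_closure_image]
  refine closure_mono (fun b hb => ?_) hzB
  exact ⟨g ⟨b, hb⟩, mem_range_self _, hg ⟨b, hb⟩⟩

/-- Countable tightness of a subspace, in terms of closures in the ambient space. -/
theorem CountablyTight.exists_countable_of_mem_closure {X : Type*} [TopologicalSpace X]
    {Z : Set X} (h : CountablyTight Z) {S : Set X} (hS : S ⊆ Z) {z : X} (hz : z ∈ Z)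
    (hzS : z ∈ closure S) : ∃ B ⊆ S, B.Countable ∧ z ∈ closure B := by
  have hz' : (⟨z, hz⟩ : Z) ∈ closure ((↑) ⁻¹' S : Set Z) := by
    rw [closure_subtype, Subtype.image_preimage_coe, inter_eq_right.2 hS]
    exact hzS
  obtain ⟨B, hBS, hB, hzB⟩ := h _ _ hz'
  exact ⟨(↑) '' B, image_subset_iff.2 hBS, hB.image _, closure_subtype.1 hzB⟩

/-- An uncountable set splits into two disjoint uncountable sets. -/
theorem exists_disjoint_not_countable {I : Type*} {J : Set I} (hJ : ¬ J.Countable) :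
    ∃ J₁ ⊆ J, ∃ J₂ ⊆ J, ¬ J₁.Countable ∧ ¬ J₂.Countable ∧ Disjoint J₁ J₂ := by
  have hinf : Infinite J := by
    rw [infinite_coe_iff]
    exact fun h => hJ h.countable
  have hc : Cardinal.mk (J ⊕ J) = Cardinal.mk J := by
    simp
  obtain ⟨e⟩ := Cardinal.eq.1 hc
  have hinj₁ : Function.Injective fun j => (e (.inl j) : I) :=
    Subtype.val_injective.comp (e.injective.comp Sum.inl_injective)
  have hinj₂ : Function.Injective fun j => (e (.inr j) : I) :=
    Subtype.val_injective.comp (e.injective.comp Sum.inr_injective)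
  refine ⟨range fun j => (e (.inl j) : I), ?_, range fun j => (e (.inr j) : I), ?_, ?_, ?_, ?_⟩
  · rintro _ ⟨j, rfl⟩
    exact (e _).2
  · rintro _ ⟨j, rfl⟩
    exact (e _).2
  · intro h
    have := h.to_subtype
    exact hJ (countable_coe_iff.1 (rangeFactorization_injective.2 hinj₁).countable)
  · intro h
    have := h.to_subtype
    exact hJ (countable_coe_iff.1 (rangeFactorization_injective.2 hinj₂).countable)
  · rw [Set.disjoint_left]
    rintro _ ⟨j, rfl⟩ ⟨k, hk⟩
    simpa using e.injective (Subtype.val_injective hk)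

/-- `K` meets every cell of the family of pairs `C` over some uncountable index set. -/
def MeetsUncountablyManyCells {X I : Type*} (C : I → Bool → Set X) (K : Set X) : Prop :=
  ∃ J : Set I, ¬ J.Countable ∧ ∀ x : I → Bool, (K ∩ ⋂ j ∈ J, C j (x j)).Nonempty

theorem MeetsUncountablyManyCells.exists_disjoint {X I : Type*} [TopologicalSpace X]
    [CompactSpace X] {C : I → Bool → Set X} (hC : ∀ i b, IsClosed (C i b))
    (hdisj : ∀ i, Disjoint (C i false) (C i true)) {K Z : Set X} (hK : IsClosed K)
    (hKC : MeetsUncountablyManyCells C K) (hZ : CountablyTight Z) :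
    ∃ L ⊆ K, IsClosed L ∧ MeetsUncountablyManyCells C L ∧ Disjoint L Z := by
  classical
  obtain ⟨J, hJ, hKJ⟩ := hKC
  obtain ⟨J₁, hJ₁J, J₂, hJ₂J, hJ₁, hJ₂, hJJ⟩ := exists_disjoint_not_countable hJ
  set S : Set X := {z | z ∈ K ∧ z ∈ Z ∧ {j | j ∈ J₁ ∧ z ∉ C j false}.Countable}
  have hSK : closure S ⊆ K := closure_minimal (fun z hz => hz.1) hK
  have hSZ : ∀ z ∈ closure S, z ∈ Z → {j | j ∈ J₁ ∧ z ∉ C j false}.Countable := by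
    intro z hz hzZ
    obtain ⟨B, hBS, hB, hzB⟩ :=
      hZ.exists_countable_of_mem_closure (fun z hz => hz.2.1) hzZ hz
    refine (hB.biUnion fun b hb => (hBS hb).2.2).mono ?_
    rintro j ⟨hj, hzj⟩
    by_contra hcon
    simp only [mem_iUnion, mem_ofPred_eq, not_exists, not_and, not_not] at hcon
    exact hzj (closure_minimal (fun b hb => hcon b hb hj) (hC j false) hzB)
  by_cases hfull : ∀ x : I → Bool, (closure S ∩ ⋂ j ∈ J, C j (x j)).Nonempty
  · refine ⟨closure S ∩ ⋂ j ∈ J₁, C j true, inter_subset_left.trans hSK,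
      isClosed_closure.inter (isClosed_biInter fun j _ => hC j true), ⟨J₂, hJ₂, fun x => ?_⟩, ?_⟩
    · obtain ⟨z, hz, hzx⟩ := hfull fun j => if j ∈ J₁ then true else x j
      simp only [mem_iInter] at hzx
      refine ⟨z, ⟨hz, ?_⟩, ?_⟩
      · simp only [mem_iInter]
        intro j hj
        simpa [hj] using hzx j (hJ₁J hj)
      · simp only [mem_iInter]
        intro j hj
        simpa [Set.disjoint_right.1 hJJ hj] using hzx j (hJ₂J hj)
    · rw [Set.disjoint_left]
      rintro z ⟨hz, hz₁⟩ hzZ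
      simp only [mem_iInter] at hz₁
      have hsub : J₁ ⊆ {j | j ∈ J₁ ∧ z ∉ C j false} := fun j hj =>
        ⟨hj, Set.disjoint_right.1 (hdisj j) (hz₁ j hj)⟩
      exact hJ₁ ((hSZ z hz hzZ).mono hsub)
  · push Not at hfull
    obtain ⟨x, hx⟩ := hfull
    obtain ⟨F, hF⟩ : ∃ F : Finset J, closure S ∩ ⋂ j ∈ F, C j (x j) = ∅ := by
      by_contra! hcon
      obtain ⟨z, hz, hzx⟩ := isClosed_closure.isCompact.inter_iInter_nonempty
        (fun j : J => C j (x j)) (fun j => hC j (x j)) hcon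
      have hmem : z ∈ closure S ∩ ⋂ j ∈ J, C j (x j) :=
        ⟨hz, mem_iInter₂.2 fun j hj => mem_iInter.1 hzx ⟨j, hj⟩⟩
      rwa [hx] at hmem
    set E : Set I := (↑) '' (F : Set J)
    have hEf : E.Finite := F.finite_toSet.image _
    have hEJ : E ⊆ J := by
      rintro _ ⟨j, -, rfl⟩
      exact j.2
    refine ⟨K ∩ ((⋂ j ∈ E, C j (x j)) ∩ ⋂ j ∈ J₁ \ E, C j false), inter_subset_left,
      hK.inter ((isClosed_biInter fun j _ => hC j _).inter (isClosed_biInter fun j _ => hC j _)),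
      ⟨J₂ \ E, fun h => hJ₂ ?_, fun u => ?_⟩, ?_⟩
    · exact (h.union hEf.countable).mono (by simp)
    · obtain ⟨z, hz, hzu⟩ := hKJ fun j => if j ∈ E then x j else if j ∈ J₁ then false else u j
      simp only [mem_iInter] at hzu
      refine ⟨z, ⟨hz, mem_iInter₂.2 fun j hj => ?_, mem_iInter₂.2 fun j hj => ?_⟩,
        mem_iInter₂.2 fun j hj => ?_⟩
      · simpa only [if_pos hj] using hzu j (hEJ hj)
      · simpa only [if_neg hj.2, if_pos hj.1] using hzu j (hJ₁J hj.1)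
      · simpa only [if_neg hj.2, if_neg (Set.disjoint_right.1 hJJ hj.1)] using hzu j (hJ₂J hj.1)
    · rw [Set.disjoint_left]
      rintro z ⟨hzK, hzE, hz₁⟩ hzZ
      have hzS : z ∈ S := by
        refine ⟨hzK, hzZ, hEf.countable.mono ?_⟩
        rintro j ⟨hj, hzj⟩
        by_contra hjE
        exact hzj (mem_iInter₂.1 hz₁ j ⟨hj, hjE⟩)
      refine eq_empty_iff_forall_notMem.1 hF z ⟨subset_closure hzS, ?_⟩
      exact mem_iInter₂.2 fun j hj => mem_iInter₂.1 hzE j ⟨j, hj, rfl⟩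

/-- The open set `G` is split by a pair of open sets with disjoint closures, each of which
meets every member of `𝒢` contained in `G`. -/
def IsSplit {X : Type*} [TopologicalSpace X] (𝒢 : Set (Set X)) (G : Set X) : Prop :=
  ∃ O : Bool → Set X, (∀ b, IsOpen (O b)) ∧ Disjoint (closure (O false)) (closure (O true)) ∧
    ∀ P ∈ 𝒢, P ⊆ G → ∀ b, (P ∩ O b).Nonempty

theorem IsSplit.mono {X : Type*} [TopologicalSpace X] {𝒢 𝒢' : Set (Set X)} {G : Set X}
    (h : IsSplit 𝒢' G) (hsub : 𝒢 ⊆ 𝒢') : IsSplit 𝒢 G := by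
  obtain ⟨O, hO, hd, hm⟩ := h
  exact ⟨O, hO, hd, fun P hP => hm P (hsub hP)⟩

/-- If no point has a local `π`-base contained in `𝒢`, then some member of `𝒢` is split. -/
theorem exists_isSplit {X : Type*} [TopologicalSpace X] [CompactSpace X] [T2Space X]
    {𝒢 : Set (Set X)} (hne : ∀ P ∈ 𝒢, P.Nonempty)
    (huniv : univ ∈ 𝒢) (hπ : ∀ y, ∃ U : Set X, IsOpen U ∧ y ∈ U ∧ ∀ P ∈ 𝒢, ¬ P ⊆ U) :
    ∃ G ∈ 𝒢, IsSplit 𝒢 G := by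
  classical
  have hV : ∀ y, ∃ V W : Set X, IsOpen V ∧ IsOpen W ∧ y ∈ V ∧ closure V ⊆ W ∧
      ∀ P ∈ 𝒢, ¬ P ⊆ closure W := by
    intro y
    obtain ⟨U, hU, hyU, hPU⟩ := hπ y
    obtain ⟨W, hW, hyW, hWU⟩ :=
      normal_exists_closure_subset isClosed_singleton hU (singleton_subset_iff.2 hyU)
    obtain ⟨V, hV, hyV, hVW⟩ :=
      normal_exists_closure_subset isClosed_singleton hW hyW
    exact ⟨V, W, hV, hW, singleton_subset_iff.1 hyV, hVW, fun P hP h => hPU P hP (h.trans hWU)⟩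
  choose V W hVo hWo hyV hVW hPW using hV
  have hex : ∃ n, ∃ t : Finset X, t.card = n ∧ ∃ G ∈ 𝒢, G ⊆ ⋃ y ∈ t, V y := by
    obtain ⟨t, ht⟩ := isCompact_univ.elim_finite_subcover V hVo
      fun y _ => mem_iUnion.2 ⟨y, hyV y⟩
    exact ⟨_, t, rfl, univ, huniv, ht⟩
  obtain ⟨t, htn, G, hG, hGt⟩ := Nat.find_spec hex
  have hmin := fun m => Nat.find_min hex (m := m)
  rw [← htn] at hmin
  obtain ⟨g, hg⟩ := hne G hG
  obtain ⟨y, hy, -⟩ := mem_iUnion₂.1 (hGt hg)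
  refine ⟨G, hG, fun b => bif b then (closure (W y))ᶜ else V y, ?_, ?_, ?_⟩
  · rintro (_ | _)
    · exact hVo y
    · exact isClosed_closure.isOpen_compl
  · refine Disjoint.mono (hVW y) (?_ : _ ⊆ (W y)ᶜ) disjoint_compl_right
    exact closure_minimal (compl_subset_compl.2 subset_closure) (hWo y).isClosed_compl
  · rintro P hP hPG (_ | _)
    · by_contra hcon
      refine hmin (t.erase y).card (Finset.card_erase_lt_of_mem hy) ⟨_, rfl, P, hP, ?_⟩
      intro p hp
      obtain ⟨z, hz, hpz⟩ := mem_iUnion₂.1 (hGt (hPG hp))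
      have hzy : z ≠ y := by
        rintro rfl
        exact hcon ⟨p, hp, hpz⟩
      exact mem_iUnion₂.2 ⟨z, Finset.mem_erase.2 ⟨hzy, hz⟩, hpz⟩
    · exact inter_compl_nonempty_iff.2 (hPW y P hP)

/-- If no point has countable `π`-character, then some nonempty open set is split for every
countable family of nonempty open sets. -/
theorem exists_forall_isSplit {X : Type*} [TopologicalSpace X] [CompactSpace X] [T2Space X]
    [Nonempty X]
    (hπ : ∀ 𝒢 : Set (Set X), 𝒢.Countable → (∀ P ∈ 𝒢, IsOpen P ∧ P.Nonempty) →
      ∀ y, ∃ U : Set X, IsOpen U ∧ y ∈ U ∧ ∀ P ∈ 𝒢, ¬ P ⊆ U) :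
    ∃ G : Set X, IsOpen G ∧ G.Nonempty ∧ ∀ 𝒢 : Set (Set X), 𝒢.Countable →
      (∀ P ∈ 𝒢, IsOpen P ∧ P.Nonempty) → IsSplit 𝒢 G := by
  by_contra! hcon
  have hbad : ∀ G : Set X, ∃ 𝒢 : Set (Set X), 𝒢.Countable ∧ (∀ P ∈ 𝒢, IsOpen P ∧ P.Nonempty) ∧
      (IsOpen G → G.Nonempty → ¬ IsSplit 𝒢 G) := by
    intro G
    by_cases hG : IsOpen G ∧ G.Nonempty
    · obtain ⟨𝒢, h₁, h₂, h₃⟩ := hcon G hG.1 hG.2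
      exact ⟨𝒢, h₁, h₂, fun _ _ => h₃⟩
    · exact ⟨∅, countable_empty, by simp, fun h₁ h₂ => absurd ⟨h₁, h₂⟩ hG⟩
  choose f hfc hfo hf using hbad
  let 𝒜 : ℕ → Set (Set X) := fun n => Nat.rec {univ} (fun _ 𝒢 => ⋃ G ∈ 𝒢, f G) n
  have h𝒜 : ∀ n, (𝒜 n).Countable ∧ ∀ P ∈ 𝒜 n, IsOpen P ∧ P.Nonempty := by
    intro n
    induction n with
    | zero => exact ⟨countable_singleton _, by rintro _ rfl; exact ⟨isOpen_univ, univ_nonempty⟩⟩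
    | succ n ih =>
      refine ⟨ih.1.biUnion fun G _ => hfc G, fun P hP => ?_⟩
      obtain ⟨G, -, hP⟩ := mem_iUnion₂.1 hP
      exact hfo G P hP
  have hU : ∀ P ∈ ⋃ n, 𝒜 n, IsOpen P ∧ P.Nonempty := by
    intro P hP
    obtain ⟨n, hn⟩ := mem_iUnion.1 hP
    exact (h𝒜 n).2 P hn
  obtain ⟨G, hG, hsplit⟩ := exists_isSplit (fun P hP => (hU P hP).2)
    (mem_iUnion.2 ⟨0, rfl⟩) (hπ _ (countable_iUnion fun n => (h𝒜 n).1) hU)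
  refine hf G (hU G hG).1 (hU G hG).2 (hsplit.mono fun P hP => ?_)
  obtain ⟨n, hn⟩ := mem_iUnion.1 hG
  exact mem_iUnion.2 ⟨n + 1, mem_iUnion₂.2 ⟨G, hn, hP⟩⟩

/-- If no point has countable `π`-character, there is an uncountable independent family of
pairs of open sets with disjoint closures. -/
theorem exists_uncountable_independent {X : Type*} [TopologicalSpace X] [CompactSpace X]
    [T2Space X] [Nonempty X]
    (hπ : ∀ 𝒢 : Set (Set X), 𝒢.Countable → (∀ P ∈ 𝒢, IsOpen P ∧ P.Nonempty) →
      ∀ y, ∃ U : Set X, IsOpen U ∧ y ∈ U ∧ ∀ P ∈ 𝒢, ¬ P ⊆ U) :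
    ∃ 𝓘 : Set (Bool → Set X), ¬ 𝓘.Countable ∧
      (∀ O ∈ 𝓘, Disjoint (closure (O false)) (closure (O true))) ∧
      ∀ t : Finset (Bool → Set X), ↑t ⊆ 𝓘 → ∀ x : (Bool → Set X) → Bool,
        (⋂ O ∈ t, O (x O)).Nonempty := by
  classical
  obtain ⟨G, hGo, hGne, hG⟩ := exists_forall_isSplit hπ
  obtain ⟨𝓘, h𝓘⟩ := zorn_subset {𝓘 : Set (Bool → Set X) |
      (∀ O ∈ 𝓘, (∀ b, IsOpen (O b)) ∧ Disjoint (closure (O false)) (closure (O true))) ∧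
      ∀ t : Finset (Bool → Set X), ↑t ⊆ 𝓘 → ∀ x : (Bool → Set X) → Bool,
        (G ∩ ⋂ O ∈ t, O (x O)).Nonempty} (by
    intro c hc hchain
    refine ⟨⋃₀ c, ⟨?_, ?_⟩, fun s hs => subset_sUnion_of_mem hs⟩
    · rintro O ⟨s, hs, hO⟩
      exact (hc hs).1 O hO
    · intro t ht x
      rcases c.eq_empty_or_nonempty with rfl | hcne
      · have : t = ∅ := by simpa using ht
        simpa [this] using hGne
      · obtain ⟨s, hs, hts⟩ := hchain.directedOn.exists_mem_subset_of_finset_subset_biUnion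
          (f := id) hcne (s := t) (by simpa [sUnion_eq_biUnion] using ht)
        exact (hc hs).2 t hts x)
  obtain ⟨hpair, hind⟩ := h𝓘.prop
  refine ⟨𝓘, fun hcount => ?_, fun O hO => (hpair O hO).2,
    fun t ht x => (hind t ht x).mono inter_subset_right⟩
  let 𝒢 : Set (Set X) := {P | P.Nonempty} ∩ (fun t : Set ((Bool → Set X) × Bool) =>
    G ∩ ⋂ q ∈ t, q.1 q.2) '' {t | t.Finite ∧ t ⊆ 𝓘 ×ˢ univ}
  have h𝒢c : 𝒢.Countable := ((countable_ofPred_finite_subset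
    (hcount.prod countable_univ)).image _).mono inter_subset_right
  have h𝒢o : ∀ P ∈ 𝒢, IsOpen P ∧ P.Nonempty := by
    rintro _ ⟨hne, t, ⟨htf, ht⟩, rfl⟩
    exact ⟨hGo.inter (htf.isOpen_biInter fun q hq => (hpair _ (ht hq).1).1 _), hne⟩
  have hcell : ∀ t : Finset (Bool → Set X), ↑t ⊆ 𝓘 → ∀ x : (Bool → Set X) → Bool,
      (G ∩ ⋂ O ∈ t, O (x O)) ∈ 𝒢 := by
    intro t ht x
    refine ⟨hind t ht x, (fun O => (O, x O)) '' t, ⟨t.finite_toSet.image _, ?_⟩, ?_⟩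
    · rintro _ ⟨O, hO, rfl⟩
      exact ⟨ht hO, mem_univ _⟩
    · simp only [biInter_image, Finset.mem_coe]
  obtain ⟨O, hO, hOd, hOm⟩ := hG 𝒢 h𝒢c h𝒢o
  have hO𝓘 : O ∈ 𝓘 := by
    refine h𝓘.le_of_ge (y := insert O 𝓘) ⟨?_, ?_⟩ (subset_insert _ _) (mem_insert _ _)
    · rintro O' (rfl | hO')
      · exact ⟨hO, hOd⟩
      · exact hpair O' hO'
    · intro t ht x
      have ht' : ↑(t.erase O) ⊆ 𝓘 := by
        intro O' hO'
        have := Finset.mem_erase.1 hO'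
        exact (ht this.2).resolve_left this.1
      obtain ⟨z, ⟨hzG, hz⟩, hzO⟩ := hOm _ (hcell _ ht' x) inter_subset_left (x O)
      refine ⟨z, hzG, mem_iInter₂.2 fun O' hO' => ?_⟩
      by_cases h : O' = O
      · rw [h]
        exact hzO
      · exact mem_iInter₂.1 hz O' (Finset.mem_erase.2 ⟨h, hO'⟩)
  obtain ⟨z, ⟨-, hz⟩, hz'⟩ := hOm _ (hcell {O} (by simpa using hO𝓘) fun _ => true)
    inter_subset_left false
  simp only [Finset.mem_singleton, iInter_iInter_eq_left] at hz
  exact Set.disjoint_left.1 hOd (subset_closure hz') (subset_closure hz)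

/-- A nonempty compact Hausdorff space covered by countably many countably tight subspaces has
a point of countable `π`-character. -/
theorem exists_countable_local_pi_base {X : Type*} [TopologicalSpace X] [CompactSpace X]
    [T2Space X] [Nonempty X] (A : ℕ → Set X) (hct : ∀ n, CountablyTight (A n))
    (hcover : ⋃ n, A n = univ) :
    ∃ y : X, ∃ pb : Set (Set X), pb.Countable ∧ (∀ P ∈ pb, IsOpen P ∧ P.Nonempty) ∧
      ∀ U : Set X, IsOpen U → y ∈ U → ∃ P ∈ pb, P ⊆ U := by
  by_contra! hcon
  obtain ⟨𝓘, h𝓘, hdisj, hind⟩ :=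
    exists_uncountable_independent fun 𝒢 h₁ h₂ y => hcon y 𝒢 h₁ h₂
  let C : 𝓘 → Bool → Set X := fun O b => closure (O.1 b)
  have hC : ∀ O b, IsClosed (C O b) := fun _ _ => isClosed_closure
  have huniv : MeetsUncountablyManyCells C univ := by
    classical
    refine ⟨univ, fun h => h𝓘 (countable_coe_iff.1 (countable_univ_iff.1 h)), fun x => ?_⟩
    simp only [mem_univ, iInter_true]
    refine isCompact_univ.inter_iInter_nonempty _ (fun O => hC O (x O)) fun t => ?_
    obtain ⟨z, hz⟩ := hind (t.map (Function.Embedding.subtype _)) (by simp)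
      fun O => if h : O ∈ 𝓘 then x ⟨O, h⟩ else true
    refine ⟨z, mem_univ z, mem_iInter₂.2 fun O hO => subset_closure ?_⟩
    simpa [O.2] using mem_iInter₂.1 hz O.1 (Finset.mem_map_of_mem _ hO)
  choose! next hsub hclosed hmeets hmiss using fun (n : ℕ) (K : Set X)
    (h : IsClosed K ∧ MeetsUncountablyManyCells C K) =>
      h.2.exists_disjoint hC (fun O => hdisj O.1 O.2) h.1 (hct n)
  let K : ℕ → Set X := fun n => Nat.rec univ next n
  have hK : ∀ n, IsClosed (K n) ∧ MeetsUncountablyManyCells C (K n) := by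
    intro n
    induction n with
    | zero => exact ⟨isClosed_univ, huniv⟩
    | succ n ih => exact ⟨hclosed n _ ih, hmeets n _ ih⟩
  obtain ⟨z, hz⟩ := IsCompact.nonempty_iInter_of_sequence_nonempty_isCompact_isClosed K
    (fun n => hsub n _ (hK n))
    (fun n => by
      obtain ⟨J, -, hJ⟩ := (hK n).2
      exact (hJ fun _ => true).mono inter_subset_left)
    isCompact_univ fun n => (hK n).1
  obtain ⟨n, hn⟩ := mem_iUnion.1 (hcover ▸ mem_univ z)
  exact Set.disjoint_left.1 (hmiss n _ (hK n)) (mem_iInter.1 hz (n + 1)) hn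

theorem stmt_4 {X : Type*} [TopologicalSpace X] [CompactSpace X] [T2Space X]
    (A : ℕ → Set X) (hct : ∀ n, CountablyTight ↥(A n)) (hcover : ⋃ n, A n = univ)
    (Y : Set X) (hY : IsClosed Y) (hne : Y.Nonempty) :
    ∃ y : ↥Y, ∃ pb : Set (Set ↥Y), pb.Countable ∧
      (∀ P ∈ pb, IsOpen P ∧ P.Nonempty) ∧
      ∀ U : Set ↥Y, IsOpen U → y ∈ U → ∃ P ∈ pb, P ⊆ U := by
  have := isCompact_iff_compactSpace.1 hY.isCompact
  have := hne.to_subtype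
  refine exists_countable_local_pi_base (fun n => (↑) ⁻¹' A n) (fun n => ?_) ?_
  · exact (hct n).of_isInducing
      (Topology.IsInducing.subtypeVal.restrictPreimage (A n))
  · rw [← preimage_iUnion, hcover, preimage_univ]
end

section
/- Let X be a compact Hausdorff space admitting two covers 𝒴 and ℋ such that: (1) |𝒴| ≤ 𝔠 and every Y ∈ 𝒴 is a countably tight dense subspace of X; (2) every H ∈ ℋ is a nonempty closed Gδ subset of X with weight w(H) ≤ 𝔠. Then w(X) ≤ 𝔠. -/
open Set Cardinal

/-- The weight of `Z` is at most `κ`: there is a topological basis of cardinality `≤ κ`. -/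
def WeightLE (Z : Type*) [TopologicalSpace Z] (κ : Cardinal) : Prop :=
  ∃ B : Set (Set Z), TopologicalSpace.IsTopologicalBasis B ∧ #B ≤ κ

open Topology TopologicalSpace

section CardinalBounds

variable {α : Type*} {ι : Type*}

theorem mk_range_le_continuum (f : ι → α) (h : #ι ≤ continuum) :
    #(Set.range f) ≤ continuum :=
  lift_le_continuum.1 (mk_range_le_lift.trans (lift_le_continuum.2 h))

theorem mk_iUnion_le_continuum (f : ι → Set α) (h : #ι ≤ continuum)
    (hf : ∀ i, #(f i) ≤ continuum) : #(⋃ i, f i : Set α) ≤ continuum := by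
  refine lift_le_continuum.1 (mk_iUnion_le_sum_mk_lift.trans ((sum_le_sum _ _ hf).trans ?_))
  rw [sum_const, lift_continuum]
  exact (mul_le_mul' (lift_le_continuum.2 h) le_rfl).trans continuum_mul_self.le

theorem mk_finset_le_continuum (h : #ι ≤ continuum) : #(Finset ι) ≤ continuum := by
  classical
  exact (mk_le_of_surjective List.toFinset_surjective).trans
    ((mk_list_le_max ι).trans (max_le aleph0_le_continuum h))

theorem mk_nat_arrow_le_continuum (h : #ι ≤ continuum) : #(ℕ → ι) ≤ continuum := by
  rw [mk_arrow, mk_nat, lift_aleph0, lift_uzero]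
  exact (power_le_power_right h).trans continuum_power_aleph0.le

theorem mk_prod_le_continuum (hα : #α ≤ continuum) (hι : #ι ≤ continuum) :
    #(α × ι) ≤ continuum := by
  rw [mk_prod, ← continuum_mul_self]
  exact mul_le_mul' (lift_le_continuum.2 hα) (lift_le_continuum.2 hι)

theorem mk_union_le_continuum {s t : Set α} (hs : #s ≤ continuum) (ht : #t ≤ continuum) :
    #(s ∪ t : Set α) ≤ continuum :=
  (mk_union_le s t).trans ((add_le_add hs ht).trans continuum_add_self.le)

theorem exists_real_range_eq {s : Set α} (hne : s.Nonempty) (hs : #s ≤ continuum) :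
    ∃ f : ℝ → α, Set.range f = s := by
  have : Nonempty s := hne.to_subtype
  obtain ⟨e⟩ : Nonempty (s ↪ ℝ) :=
    lift_mk_le'.1 (by rw [mk_real, lift_continuum]; exact lift_le_continuum.2 hs)
  refine ⟨fun r => (Function.invFun e r : s), ?_⟩
  rw [← Function.comp_def, Set.range_comp, (Function.invFun_surjective e.injective).range_eq,
    Set.image_univ, Subtype.range_coe]

/-- At most continuum many operations of countable arity admit a nonempty closed set of size
at most the continuum. -/
theorem exists_closed_under_countable_operations [Nonempty α] (hι : #ι ≤ continuum)
    (op : ι → (ℕ → α) → α) :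
    ∃ S : Set α, S.Nonempty ∧ #S ≤ continuum ∧ ∀ i a, (∀ n, a n ∈ S) → op i a ∈ S := by
  let β : Option ι → Type := fun o => o.elim PEmpty fun _ => ℕ
  let step : ((o : Option ι) × (β o → α)) → α := fun p =>
    match p with
    | ⟨none, _⟩ => Classical.arbitrary α
    | ⟨some i, a⟩ => op i a
  refine ⟨Set.range (WType.elim α step), ⟨_, WType.mk none PEmpty.elim, rfl⟩,
    mk_range_le_continuum _ (WType.cardinalMk_le_of_le' ?_), fun i a ha => ?_⟩
  · refine (sum_le_sum _ (fun _ => continuum) ?_).trans ?_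
    · rintro (_ | i)
      · change continuum ^ lift #PEmpty ≤ _
        simpa using one_le_aleph0.trans aleph0_le_continuum
      · change continuum ^ lift #ℕ ≤ _
        simp
    · rw [sum_const, lift_continuum]
      refine (mul_le_mul' (lift_le_continuum.2 ?_) le_rfl).trans continuum_mul_self.le
      rw [mk_option, ← continuum_add_self]
      exact add_le_add hι (one_le_aleph0.trans aleph0_le_continuum)
  · choose t ht using ha
    exact ⟨WType.mk (some i) t, congrArg (op i) (funext ht)⟩

end CardinalBounds

section LocalBases

variable {X : Type*} [TopologicalSpace X] [CompactSpace X]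

/-- A closed `Gδ` set of weight at most the continuum has at most continuum many open sets that
separate its points from all other points. -/
theorem exists_separating_family [T2Space X] {H : Set X} (hc : IsClosed H) (hG : IsGδ H)
    (hw : WeightLE H continuum) :
    ∃ W : Set (Set X), #W ≤ continuum ∧ (∀ w ∈ W, IsOpen w) ∧
      ∀ x ∈ H, ∀ y, y ≠ x → ∃ w ∈ W, x ∈ w ∧ y ∉ closure w := by
  obtain ⟨B, hB, hBc⟩ := hw
  obtain ⟨U, hUo, hU⟩ := hG.eq_iInter_nat
  have hHU : ∀ n, H ⊆ U n := fun n => hU ▸ Set.iInter_subset _ n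
  choose V hVo hHV hVU using fun n => normal_exists_closure_subset hc (hUo n) (hHU n)
  let sep (p : B × B) (w : Set X) : Prop :=
    IsOpen w ∧ Subtype.val '' p.1.1 ⊆ w ∧ Disjoint (closure w) (Subtype.val '' p.2.1)
  let g : B × B → Set X := fun p => Classical.epsilon (sep p)
  refine ⟨{w | IsOpen w} ∩ (Set.range V ∪ Set.range g),
    (mk_le_mk_of_subset Set.inter_subset_right).trans (mk_union_le_continuum
      (mk_range_le_continuum _ (mk_nat.le.trans aleph0_le_continuum))
      (mk_range_le_continuum _ (mk_prod_le_continuum hBc hBc))),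
    fun w hw => hw.1, fun x hx y hyx => ?_⟩
  by_cases hy : y ∈ H
  · obtain ⟨u, hxu, hu, v, hyv, hv, huv⟩ := exists_open_nhds_disjoint_closure hyx.symm
    obtain ⟨b, hb, hxb, hbu⟩ := hB.exists_subset_of_mem_open (a := ⟨x, hx⟩) hxu
      (hu.preimage continuous_subtype_val)
    obtain ⟨c, hcB, hyc, hcv⟩ := hB.exists_subset_of_mem_open (a := ⟨y, hy⟩) hyv
      (hv.preimage continuous_subtype_val)
    have hg : sep (⟨b, hb⟩, ⟨c, hcB⟩) (g (⟨b, hb⟩, ⟨c, hcB⟩)) :=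
      Classical.epsilon_spec (p := sep (⟨b, hb⟩, ⟨c, hcB⟩)) ⟨u, hu, Set.image_subset_iff.2 hbu,
        huv.mono_right ((Set.image_subset_iff.2 hcv).trans subset_closure)⟩
    exact ⟨_, ⟨hg.1, Or.inr ⟨_, rfl⟩⟩, hg.2.1 ⟨_, hxb, rfl⟩,
      fun h => Set.disjoint_left.1 hg.2.2 h ⟨_, hyc, rfl⟩⟩
  · rw [hU, Set.mem_iInter, not_forall] at hy
    obtain ⟨n, hn⟩ := hy
    exact ⟨V n, ⟨hVo n, Or.inl ⟨n, rfl⟩⟩, hHV n hx, fun h => hn (hVU n h)⟩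

/-- Finite intersections of a separating family contain local bases. -/
theorem exists_local_bases_of_separating {C : Set X} {W : Set (Set X)} (hW : #W ≤ continuum)
    (hWo : ∀ w ∈ W, IsOpen w)
    (hsep : ∀ x ∈ C, ∀ y, y ≠ x → ∃ w ∈ W, x ∈ w ∧ y ∉ closure w) :
    ∃ b : ℝ → Set X, (∀ r, IsOpen (b r)) ∧
      ∀ x ∈ C, ∀ U, IsOpen U → x ∈ U → ∃ r, x ∈ b r ∧ b r ⊆ U := by
  classical
  let g : Finset W → Set X := fun F => ⋂ w ∈ F, (w : Set X)
  obtain ⟨b, hb⟩ := exists_real_range_eq (Set.range_nonempty g)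
    (mk_range_le_continuum g (mk_finset_le_continuum hW))
  refine ⟨b, fun r => ?_, fun x hx U hU hxU => ?_⟩
  · obtain ⟨F, hF⟩ : b r ∈ Set.range g := hb ▸ ⟨r, rfl⟩
    rw [← hF]
    exact isOpen_biInter_finset fun w _ => hWo w w.2
  · obtain ⟨F, hF⟩ := hU.isClosed_compl.isCompact.elim_finite_subfamily_closed
      (fun w : {w : W // x ∈ (w : Set X)} => closure (w : Set X)) (fun _ => isClosed_closure)
      (by
        refine Set.eq_empty_of_forall_notMem fun y hy => ?_
        obtain ⟨w, hw, hxw, hyw⟩ := hsep x hx y fun h => hy.1 (h ▸ hxU)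
        exact hyw (Set.mem_iInter.1 hy.2 ⟨⟨w, hw⟩, hxw⟩))
    obtain ⟨r, hr⟩ : g (F.map (Function.Embedding.subtype _)) ∈ Set.range b := hb ▸ ⟨_, rfl⟩
    refine ⟨r, ?_, fun y hy => ?_⟩
    · rw [hr]
      simp only [g, Set.mem_iInter, Finset.mem_map]
      rintro w ⟨v, -, rfl⟩
      exact v.2
    · rw [hr] at hy
      by_contra hyU
      refine (hF ▸ Set.notMem_empty y) ⟨hyU, Set.mem_iInter₂.2 fun w hw => subset_closure ?_⟩
      exact Set.mem_iInter₂.1 hy _ (Finset.mem_map_of_mem _ hw)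

/-- If `X` is covered by closed `Gδ` sets of weight at most the continuum, then at most continuum
many open sets contain local bases at all points in the closure of a given countable set. -/
theorem exists_local_bases_closure_range [T2Space X] {ℋ : Set (Set X)}
    (hcover : ⋃₀ ℋ = Set.univ)
    (hℋ : ∀ H ∈ ℋ, IsClosed H ∧ IsGδ H ∧ WeightLE H continuum) (a : ℕ → X) :
    ∃ b : ℝ → Set X, (∀ r, IsOpen (b r)) ∧
      ∀ x ∈ closure (Set.range a), ∀ U, IsOpen U → x ∈ U → ∃ r, x ∈ b r ∧ b r ⊆ U := by
  choose! W hWc hWo hWsep using fun H hH =>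
    exists_separating_family (hℋ H hH).1 (hℋ H hH).2.1 (hℋ H hH).2.2
  let K (N : ℕ → Set ℕ) : Set X := ⋂ n, closure (a '' N n)
  let h (N : ℕ → Set ℕ) : Set X := Classical.epsilon fun H => H ∈ ℋ ∧ K N ⊆ H
  have hcard : #{N // h N ∈ ℋ} ≤ continuum :=
    (mk_subtype_le _).trans (mk_nat_arrow_le_continuum mk_set_nat.le)
  refine exists_local_bases_of_separating (W := ⋃ N : {N // h N ∈ ℋ}, W (h N))
    (mk_iUnion_le_continuum _ hcard fun N => hWc _ N.2) ?_ fun x hx y hyx => ?_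
  · simp only [Set.mem_iUnion]
    rintro w ⟨N, hw⟩
    exact hWo _ N.2 w hw
  · obtain ⟨H, hH, hxH⟩ : x ∈ ⋃₀ ℋ := hcover ▸ Set.mem_univ x
    obtain ⟨U, hUo, hU⟩ := (hℋ H hH).2.1.eq_iInter_nat
    have hN : ∀ n, ∃ N : Set ℕ, x ∈ closure (a '' N) ∧ closure (a '' N) ⊆ U n := fun n => by
      obtain ⟨V, hVo, hxV, hVU⟩ := normal_exists_closure_subset (isClosed_singleton (x := x))
        (hUo n) (Set.singleton_subset_iff.2 (Set.mem_iInter.1 (hU ▸ hxH) n))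
      refine ⟨a ⁻¹' V, ?_, (closure_mono (Set.image_preimage_subset a V)).trans hVU⟩
      rw [Set.image_preimage_eq_inter_range]
      exact hVo.inter_closure ⟨hxV rfl, hx⟩
    choose N hxN hNU using hN
    have hs : h N ∈ ℋ ∧ K N ⊆ h N := Classical.epsilon_spec (p := fun H => H ∈ ℋ ∧ K N ⊆ H)
      ⟨H, hH, hU ▸ Set.iInter_mono hNU⟩
    obtain ⟨w, hw, hxw, hyw⟩ := hWsep _ hs.1 x (hs.2 (Set.mem_iInter.2 hxN)) y hyx
    exact ⟨w, Set.mem_iUnion.2 ⟨⟨N, hs.1⟩, hw⟩, hxw, hyw⟩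

end LocalBases

theorem CountablyTight.exists_countable_subset {X : Type*} [TopologicalSpace X] {Y A : Set X}
    (hY : CountablyTight Y) {p : X} (hp : p ∈ Y) (hpA : p ∈ closure (A ∩ Y)) :
    ∃ B ⊆ A, B.Countable ∧ p ∈ closure B := by
  obtain ⟨B, hBA, hBc, hpB⟩ := hY (Subtype.val ⁻¹' A) ⟨p, hp⟩ (by
    rwa [closure_subtype, Subtype.image_preimage_coe, Set.inter_comm])
  exact ⟨_, Set.image_subset_iff.2 hBA, hBc.image _, closure_subtype.1 hpB⟩

theorem stmt_10 {X : Type u} [TopologicalSpace X] [CompactSpace X] [T2Space X]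
    (𝒴 ℋ : Set (Set X))
    -- (1)
    (h𝒴card : #𝒴 ≤ continuum)
    (h𝒴cover : ⋃₀ 𝒴 = Set.univ)
    (h𝒴ct : ∀ Y ∈ 𝒴, CountablyTight ↥Y)
    (h𝒴dense : ∀ Y ∈ 𝒴, Dense Y)
    -- (2)
    (hℋcover : ⋃₀ ℋ = Set.univ)
    (hℋ : ∀ H ∈ ℋ, H.Nonempty ∧ IsClosed H ∧ IsGδ H ∧ WeightLE ↥H continuum) :
    WeightLE X continuum := by
  rcases isEmpty_or_nonempty X with hX | hX
  · exact ⟨_, isTopologicalBasis_opens, (mk_set_le _).trans (by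
      simpa using one_le_aleph0.trans aleph0_le_continuum)⟩
  choose b hbo hb using
    exists_local_bases_closure_range hℋcover fun H hH => (hℋ H hH).2
  let pick (s : Set X) : X := Classical.epsilon (· ∈ s)
  have hpick : ∀ {s : Set X}, s.Nonempty → pick s ∈ s := fun hs => Classical.epsilon_spec hs
  let row (a : ℕ → X) (n k : ℕ) : X := a (Nat.pair n k)
  obtain ⟨S, ⟨s₀, hs₀⟩, hScard, hS⟩ := exists_closed_under_countable_operations
    (ι := (ℕ → ℝ) ⊕ (𝒴 × ℝ))
    (by
      rw [mk_sum, ← continuum_add_self]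
      exact add_le_add (lift_le_continuum.2 (mk_nat_arrow_le_continuum mk_real.le))
        (lift_le_continuum.2 (mk_prod_le_continuum h𝒴card mk_real.le)))
    (Sum.elim (fun r a => pick (⋃ n, b (row a n) (r n))ᶜ) fun q a => pick (b a q.2 ∩ q.1))
  have hdense : ∀ Y ∈ 𝒴, S ⊆ closure (S ∩ Y) := fun Y hY q hq => by
    refine mem_closure_iff.2 fun U hU hqU => ?_
    obtain ⟨r, hqr, hrU⟩ := hb (fun _ => q) q (subset_closure ⟨0, rfl⟩) U hU hqU
    have hmem := hpick ((h𝒴dense Y hY).inter_open_nonempty _ (hbo (fun _ => q) r) ⟨q, hqr⟩)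
    exact ⟨_, hrU hmem.1, hS (Sum.inr (⟨Y, hY⟩, r)) (fun _ => q) fun _ => hq, hmem.2⟩
  have hbase : ∀ p ∈ closure S, ∀ U, IsOpen U → p ∈ U →
      ∃ (a : ℕ → S) (r : ℝ), p ∈ b (fun n => a n) r ∧ b (fun n => a n) r ⊆ U := by
    intro p hp U hU hpU
    obtain ⟨Y, hY, hpY⟩ : p ∈ ⋃₀ 𝒴 := h𝒴cover ▸ Set.mem_univ p
    obtain ⟨B, hBS, hBc, hpB⟩ := (h𝒴ct Y hY).exists_countable_subset hpY
      (closure_minimal (hdense Y hY) isClosed_closure hp)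
    obtain ⟨a, rfl⟩ := hBc.exists_eq_range (closure_nonempty_iff.1 ⟨p, hpB⟩)
    exact ⟨fun n => ⟨a n, hBS ⟨n, rfl⟩⟩, hb a p hpB U hU hpU⟩
  have hSdense : ∀ p, p ∈ closure S := by
    by_contra! hcon
    obtain ⟨p, hp⟩ := hcon
    have : Nonempty S := ⟨⟨s₀, hs₀⟩⟩
    choose! a r hz hpr using fun z (hz : z ∈ closure S) =>
      hbase z hz {p}ᶜ isOpen_compl_singleton fun h : z = p => hp (h ▸ hz)
    obtain ⟨t, htS, ht⟩ := isClosed_closure.isCompact.elim_nhds_subcover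
      (fun z => b (fun n => a z n) (r z)) fun z hzS => (hbo _ _).mem_nhds (hz z hzS)
    have htne : (t : Set X).Nonempty := by
      obtain ⟨z, hzt, -⟩ := Set.mem_iUnion₂.1 (ht (subset_closure hs₀))
      exact ⟨z, hzt⟩
    obtain ⟨e, he⟩ := t.countable_toSet.exists_eq_range htne
    have het : ∀ n, e n ∈ t := fun n => Finset.mem_coe.1 (he ▸ ⟨n, rfl⟩)
    let a' (m : ℕ) : X := a (e m.unpair.1) m.unpair.2
    have hrow : ∀ n, row a' n = fun k => (a (e n) k : X) := fun n => by
      funext k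
      simp [row, a']
    have hout := hpick (s := (⋃ n, b (row a' n) (r (e n)))ᶜ) ⟨p, by
      simp only [Set.mem_compl_iff, Set.mem_iUnion, hrow]
      rintro ⟨n, hn⟩
      exact hpr _ (htS _ (het n)) hn rfl⟩
    obtain ⟨z, hzt, hz'⟩ := Set.mem_iUnion₂.1
      (ht (subset_closure (hS (Sum.inl fun n => r (e n)) a' fun _ => Subtype.coe_prop _)))
    obtain ⟨n, rfl⟩ : z ∈ Set.range e := he ▸ hzt
    exact hout (Set.mem_iUnion.2 ⟨n, by rw [hrow]; exact hz'⟩)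
  refine ⟨Set.range fun q : (ℕ → S) × ℝ => b (fun n => q.1 n) q.2,
    isTopologicalBasis_of_isOpen_of_nhds ?_ fun p U hpU hU => ?_, mk_range_le_continuum _
      (mk_prod_le_continuum (mk_nat_arrow_le_continuum hScard) mk_real.le)⟩
  · rintro _ ⟨q, rfl⟩
    exact hbo _ _
  · obtain ⟨a, r, hp, hrU⟩ := hbase p (hSdense p) U hU hpU
    exact ⟨_, ⟨(a, r), rfl⟩, hp, hrU⟩
end

section
/- Let X be an infinite homogeneous compact Hausdorff space that is the union of finitely many countably tight subspaces. Then |X| = 𝔠. -/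
open Set Cardinal

/-- `C` is countably tight as a subspace, expressed with closures in the ambient space. -/
def CountablyTightIn {X : Type*} [TopologicalSpace X] (C : Set X) : Prop :=
  ∀ A ⊆ C, ∀ x ∈ C, x ∈ closure A → ∃ B ⊆ A, B.Countable ∧ x ∈ closure B

/-- A regular Gδ-set: a countable intersection of open sets that is also the intersection of
their closures. -/
def IsRegularGδ {X : Type*} [TopologicalSpace X] (G : Set X) : Prop :=
  ∃ V : ℕ → Set X, (∀ n, IsOpen (V n)) ∧ (∀ n, G ⊆ V n) ∧ ⋂ n, closure (V n) ⊆ G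

/-- The point `p` has a countable local π-base. -/
def HasCountablePiBaseAt {X : Type*} [TopologicalSpace X] (p : X) : Prop :=
  ∃ U : ℕ → Set X, (∀ n, IsOpen (U n) ∧ (U n).Nonempty) ∧
    ∀ W, IsOpen W → p ∈ W → ∃ n, U n ⊆ W

/-- `D` is closed under all the maps `fun x ↦ s x n`. -/
def SeqClosedUnder {X : Type*} (s : X → ℕ → X) (D : Set X) : Prop :=
  ∀ x ∈ D, ∀ n, s x n ∈ D

/-- Countable tightness restricted to the sets closed under `s`. -/
def TightFor {X : Type*} [TopologicalSpace X] (s : X → ℕ → X) : Prop :=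
  ∀ D, SeqClosedUnder s D → ∀ x ∈ closure D, ∃ B ⊆ D, B.Countable ∧ x ∈ closure B

section General

variable {X : Type*} [TopologicalSpace X]

theorem CountablyTight.countablyTightIn {C : Set X} (h : CountablyTight C) :
    CountablyTightIn C := by
  intro A hA x hx hxA
  obtain ⟨B, hBA, hB, hxB⟩ := h ((↑) ⁻¹' A) ⟨x, hx⟩ (by
    rw [closure_subtype, Subtype.image_preimage_coe, inter_eq_right.2 hA]
    exact hxA)
  refine ⟨(↑) '' B, ?_, hB.image _, closure_subtype.1 hxB⟩
  rintro _ ⟨y, hy, rfl⟩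
  exact hBA hy

theorem CountablyTightIn.image {C : Set X} (h : CountablyTightIn C) (f : X ≃ₜ X) :
    CountablyTightIn (f '' C) := by
  rintro A hA _ ⟨x, hx, rfl⟩ hxA
  obtain ⟨B, hBA, hB, hxB⟩ := h (f ⁻¹' A) (fun y hy ↦ by
    obtain ⟨z, hz, hzy⟩ := hA hy
    rwa [← f.injective hzy]) x hx (by
    rw [← f.preimage_closure]
    exact hxA)
  refine ⟨f '' B, by rwa [image_subset_iff], hB.image _, ?_⟩
  rw [← f.image_closure]
  exact mem_image_of_mem _ hxB

theorem IsRegularGδ.isClosed {G : Set X} (h : IsRegularGδ G) : IsClosed G := by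
  obtain ⟨V, -, hGV, hVG⟩ := h
  have : G = ⋂ n, closure (V n) :=
    (subset_iInter fun n ↦ (hGV n).trans subset_closure).antisymm hVG
  rw [this]
  exact isClosed_iInter fun n ↦ isClosed_closure

theorem isRegularGδ_univ : IsRegularGδ (univ : Set X) :=
  ⟨fun _ ↦ univ, fun _ ↦ isOpen_univ, fun _ ↦ subset_univ _, subset_univ _⟩

theorem IsRegularGδ.iInter {ι : Type*} [Countable ι] {G : ι → Set X}
    (h : ∀ i, IsRegularGδ (G i)) : IsRegularGδ (⋂ i, G i) := by
  cases isEmpty_or_nonempty ι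
  · rw [iInter_of_empty]
    exact isRegularGδ_univ
  choose V hV hGV hVG using h
  obtain ⟨e, he⟩ := exists_surjective_nat (ι × ℕ)
  refine ⟨fun n ↦ V (e n).1 (e n).2, fun n ↦ hV _ _,
    fun n ↦ (iInter_subset _ _).trans (hGV _ _), fun x hx ↦ mem_iInter.2 fun i ↦ hVG i ?_⟩
  refine mem_iInter.2 fun k ↦ ?_
  obtain ⟨n, hn⟩ := he (i, k)
  have := mem_iInter.1 hx n
  simp only [hn] at this
  exact this

theorem IsRegularGδ.biInter {ι : Type*} {s : Set ι} (hs : s.Countable) {G : ι → Set X}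
    (h : ∀ i ∈ s, IsRegularGδ (G i)) : IsRegularGδ (⋂ i ∈ s, G i) := by
  have := hs.to_subtype
  rw [biInter_eq_iInter]
  exact IsRegularGδ.iInter fun i ↦ h i i.2

theorem IsRegularGδ.inter {G H : Set X} (hG : IsRegularGδ G) (hH : IsRegularGδ H) :
    IsRegularGδ (G ∩ H) := by
  rw [inter_eq_iInter]
  exact IsRegularGδ.iInter fun b ↦ by cases b <;> assumption

theorem isRegularGδ_setOf_le {f : X → ℝ} (hf : Continuous f) (c : ℝ) :
    IsRegularGδ {x | f x ≤ c} := by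
  refine ⟨fun n ↦ {x | f x < c + 1 / (n + 1 : ℝ)}, fun n ↦ isOpen_lt hf continuous_const,
    fun n x hx ↦ ?_, fun x hx ↦ ?_⟩
  · have : (0 : ℝ) < 1 / (n + 1 : ℝ) := Nat.one_div_pos_of_nat
    simp only [mem_ofPred_eq] at hx ⊢
    linarith
  · refine le_of_forall_pos_le_add (b := c) fun ε hε ↦ ?_
    obtain ⟨n, hn⟩ := exists_nat_one_div_lt hε
    have h1 := closure_lt_subset_le hf continuous_const (mem_iInter.1 hx n)
    simp only [mem_ofPred_eq] at h1
    linarith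

theorem IsRegularGδ.image {G : Set X} (hG : IsRegularGδ G) (f : X ≃ₜ X) :
    IsRegularGδ (f '' G) := by
  obtain ⟨V, hV, hGV, hVG⟩ := hG
  refine ⟨fun n ↦ f '' V n, fun n ↦ f.isOpenMap _ (hV n), fun n ↦ image_mono (hGV n), ?_⟩
  simp only [← f.image_closure]
  rw [← image_iInter f.bijective]
  exact image_mono hVG

theorem exists_isRegularGδ_subset [CompactSpace X] [T2Space X] {x : X} {U : Set X}
    (hU : IsOpen U) (hx : x ∈ U) : ∃ G, IsRegularGδ G ∧ x ∈ G ∧ G ⊆ U := by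
  obtain ⟨f, hf0, hf1, -⟩ := exists_continuous_zero_one_of_isClosed (isClosed_singleton (x := x))
    hU.isClosed_compl (by simpa using hx)
  refine ⟨_, isRegularGδ_setOf_le f.continuous 0, ?_, fun y hy ↦ ?_⟩
  · exact (hf0 rfl).le
  · by_contra h
    have := hf1 h
    simp only [mem_ofPred_eq, Pi.one_apply] at hy this
    linarith

theorem hasCountablePiBaseAt_of_isRegularGδ [CompactSpace X] {p : X} {𝓑 : Set (Set X)}
    (hc : 𝓑.Countable) (hG : ∀ B ∈ 𝓑, IsRegularGδ B ∧ B.Nonempty)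
    (h : ∀ W, IsOpen W → p ∈ W → ∃ B ∈ 𝓑, B ⊆ W) : HasCountablePiBaseAt p := by
  have : Nonempty 𝓑 := by
    obtain ⟨B, hB, -⟩ := h univ isOpen_univ (mem_univ _)
    exact ⟨⟨B, hB⟩⟩
  have := hc.to_subtype
  have hV : ∀ B : 𝓑, ∃ V : ℕ → Set X, (∀ n, IsOpen (V n)) ∧ (∀ n, B.1 ⊆ V n) ∧
      ⋂ n, closure (V n) ⊆ B := fun B ↦ (hG B B.2).1
  choose V hV hGV hVG using hV
  obtain ⟨e, he⟩ := exists_surjective_nat (𝓑 × Finset ℕ)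
  refine ⟨fun n ↦ ⋂ k ∈ (e n).2, V (e n).1 k, fun n ↦ ⟨?_, ?_⟩, fun W hW hp ↦ ?_⟩
  · exact isOpen_biInter_finset fun k _ ↦ hV _ _
  · exact (hG _ (e n).1.2).2.mono (subset_iInter₂ fun k _ ↦ hGV _ _)
  · obtain ⟨B, hB, hBW⟩ := h W hW hp
    obtain ⟨t, ht⟩ := hW.isClosed_compl.isCompact.elim_finite_subfamily_closed
      (fun n ↦ closure (V ⟨B, hB⟩ n)) (fun n ↦ isClosed_closure) (by
        rw [← disjoint_iff_inter_eq_empty, disjoint_compl_left_iff_subset]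
        exact (hVG _).trans hBW)
    obtain ⟨n, hn⟩ := he (⟨B, hB⟩, t)
    refine ⟨n, ?_⟩
    rw [← disjoint_iff_inter_eq_empty, disjoint_compl_left_iff_subset] at ht
    simp only [hn]
    exact (iInter₂_mono fun k _ ↦ subset_closure).trans ht

end General

section PiCharacter

variable {X : Type*} [TopologicalSpace X]

theorem exists_disjoint_regularGδ_meeting [CompactSpace X] [T2Space X]
    (hp : ∀ p : X, ¬ HasCountablePiBaseAt p) {𝓑 : Set (Set X)} (hc : 𝓑.Countable)
    (hne : 𝓑.Nonempty) (hG : ∀ B ∈ 𝓑, IsRegularGδ B ∧ B.Nonempty) :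
    ∃ B₀ ∈ 𝓑, ∃ P Q, IsRegularGδ P ∧ IsRegularGδ Q ∧ P ∩ Q ∩ B₀ = ∅ ∧
      ∀ B ∈ 𝓑, (B ∩ P).Nonempty ∧ (B ∩ Q).Nonempty := by
  classical
  have h1 : ∀ p : X, ∃ f : C(X, ℝ), f p = 0 ∧ ∀ B ∈ 𝓑, ∃ x ∈ B, f x = 1 := by
    intro p
    by_contra! h
    refine hp p (hasCountablePiBaseAt_of_isRegularGδ hc hG fun W hW hpW ↦ ?_)
    obtain ⟨f, hf0, hf1, -⟩ := exists_continuous_zero_one_of_isClosed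
      (isClosed_singleton (x := p)) hW.isClosed_compl (by simpa using hpW)
    obtain ⟨B, hB, hBf⟩ := h f (hf0 rfl)
    refine ⟨B, hB, fun x hx ↦ ?_⟩
    by_contra hxW
    exact hBf x hx (hf1 hxW)
  choose f hf0 hf1 using h1
  obtain ⟨t, ht⟩ := isCompact_univ.elim_finite_subcover (fun p ↦ {x | f p x < 1 / 2})
    (fun p ↦ isOpen_lt (f p).continuous continuous_const)
    (fun p _ ↦ mem_iUnion.2 ⟨p, by simp [hf0]⟩)
  have hF : ∀ p, IsRegularGδ {x | 1 / 2 ≤ f p x} := fun p ↦ by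
    simpa using isRegularGδ_setOf_le (f p).continuous.neg (-(1 / 2))
  let I : Finset X → Set X := fun T ↦ ⋂ p ∈ (T : Set X), {x | 1 / 2 ≤ f p x}
  have hI : ∀ T, IsRegularGδ (I T) := fun T ↦
    IsRegularGδ.biInter T.countable_toSet fun p _ ↦ hF p
  have hIt : I t = ∅ := by
    rw [eq_empty_iff_forall_notMem]
    intro x hx
    obtain ⟨p, hpt, hpx⟩ := mem_iUnion₂.1 (ht (mem_univ x))
    have := mem_iInter₂.1 hx p hpt
    simp only [mem_ofPred_eq] at this hpx
    linarith
  have key : ∀ T : Finset X, (∀ B ∈ 𝓑, (B ∩ I T).Nonempty) ∨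
      ∃ B₀ ∈ 𝓑, ∃ P Q, IsRegularGδ P ∧ IsRegularGδ Q ∧ P ∩ Q ∩ B₀ = ∅ ∧
      ∀ B ∈ 𝓑, (B ∩ P).Nonempty ∧ (B ∩ Q).Nonempty := by
    intro T
    induction T using Finset.induction_on with
    | empty => exact Or.inl fun B hB ↦ by simpa [I] using (hG B hB).2
    | insert p T _ ih =>
      rcases ih with ih | ih
      · by_cases h : ∀ B ∈ 𝓑, (B ∩ I (insert p T)).Nonempty
        · exact Or.inl h
        · push Not at h
          obtain ⟨B₀, hB₀, h⟩ := h
          refine Or.inr ⟨B₀, hB₀, _, _, hF p, hI T, ?_, fun B hB ↦ ⟨?_, ih B hB⟩⟩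
          · rw [inter_comm, ← h]
            simp [I]
          · obtain ⟨x, hx, hfx⟩ := hf1 p B hB
            refine ⟨x, hx, ?_⟩
            simp only [mem_ofPred_eq, hfx]
            norm_num
      · exact Or.inr ih
  rcases key t with h | h
  · obtain ⟨B, hB⟩ := hne
    have := h B hB
    simp [hIt] at this
  · exact h

theorem exists_regularGδ_splitting [CompactSpace X] [T2Space X] [Nonempty X]
    (hp : ∀ p : X, ¬ HasCountablePiBaseAt p) :
    ∃ K : Set X, IsRegularGδ K ∧ K.Nonempty ∧ ∀ 𝓑 : Set (Set X), 𝓑.Countable → 𝓑.Nonempty →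
      (∀ B ∈ 𝓑, IsRegularGδ B ∧ B.Nonempty ∧ B ⊆ K) →
      ∃ P Q, IsRegularGδ P ∧ IsRegularGδ Q ∧ Disjoint P Q ∧
        ∀ B ∈ 𝓑, (B ∩ P).Nonempty ∧ (B ∩ Q).Nonempty := by
  by_contra! h
  choose! Φ hc hne hG hΦ using h
  let step : Set (Set X) → Set (Set X) := fun 𝓒 ↦ ⋃ K ∈ 𝓒, Φ K
  let 𝓒 : ℕ → Set (Set X) := fun n ↦ step^[n] {Set.univ}
  have hsucc : ∀ n, 𝓒 (n + 1) = step (𝓒 n) := fun n ↦ Function.iterate_succ_apply' _ _ _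
  have h1 : ∀ n, (∀ K ∈ 𝓒 n, IsRegularGδ K ∧ K.Nonempty) ∧ (𝓒 n).Countable := by
    intro n
    induction n with
    | zero => simp [𝓒, isRegularGδ_univ]
    | succ n ih =>
      rw [hsucc]
      refine ⟨fun K hK ↦ ?_, ih.2.biUnion fun K hK ↦ hc K (ih.1 K hK).1 (ih.1 K hK).2⟩
      obtain ⟨L, hL, hKL⟩ := mem_iUnion₂.1 hK
      have := hG L (ih.1 L hL).1 (ih.1 L hL).2 K hKL
      exact ⟨this.1, this.2.1⟩
  obtain ⟨B₀, hB₀, P, Q, hP, hQ, hPQ, hmeet⟩ := exists_disjoint_regularGδ_meeting hp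
    (𝓑 := ⋃ n, 𝓒 n) (countable_iUnion fun n ↦ (h1 n).2)
    ⟨Set.univ, mem_iUnion.2 ⟨0, by simp [𝓒]⟩⟩ (fun B hB ↦ by
      obtain ⟨n, hn⟩ := mem_iUnion.1 hB
      exact (h1 n).1 B hn)
  obtain ⟨n, hn⟩ := mem_iUnion.1 hB₀
  have hB := (h1 n).1 B₀ hn
  obtain ⟨B, hBΦ, hBm⟩ := hΦ B₀ hB.1 hB.2 (P ∩ B₀) (Q ∩ B₀) (hP.inter hB.1) (hQ.inter hB.1) (by
    rw [disjoint_iff_inter_eq_empty, ← hPQ]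
    ext x
    simp only [mem_inter_iff]
    tauto)
  have hBs := (hG B₀ hB.1 hB.2 B hBΦ).2.2
  have hBmem : B ∈ ⋃ n, 𝓒 n := mem_iUnion.2 ⟨n + 1, by
    rw [hsucc]
    exact mem_iUnion₂.2 ⟨B₀, hn, hBΦ⟩⟩
  have h2 := hmeet B hBmem
  have h3 : ∀ R : Set X, B ∩ (R ∩ B₀) = B ∩ R := fun R ↦ by
    ext x
    simp only [mem_inter_iff]
    have := @hBs x
    tauto
  rw [h3, h3] at hBm
  exact h2.2.ne_empty (hBm h2.1)

/-- Shapirovskii: a compact space without points of countable π-character carries an uncountable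
independent family of pairs of disjoint closed sets. -/
theorem exists_uncountable_independent_s12 [CompactSpace X] [T2Space X] [Nonempty X]
    (hp : ∀ p : X, ¬ HasCountablePiBaseAt p) :
    ∃ I : Set (Set X × Set X), ¬ I.Countable ∧
      (∀ i ∈ I, IsClosed i.1 ∧ IsClosed i.2 ∧ Disjoint i.1 i.2) ∧
      ∀ F T : Finset (Set X × Set X), ↑F ⊆ I → ↑T ⊆ I → Disjoint F T →
        ((⋂ i ∈ F, i.1) ∩ ⋂ i ∈ T, i.2).Nonempty := by
  classical
  obtain ⟨K, hK, hKne, hsplit⟩ := exists_regularGδ_splitting hp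
  let meet : Finset (Set X × Set X) → Finset (Set X × Set X) → Set X := fun F T ↦
    K ∩ ((⋂ i ∈ (F : Set (Set X × Set X)), i.1) ∩ ⋂ i ∈ (T : Set (Set X × Set X)), i.2)
  obtain ⟨I, hI⟩ := zorn_subset {I : Set (Set X × Set X) |
      (∀ i ∈ I, IsRegularGδ i.1 ∧ IsRegularGδ i.2 ∧ Disjoint i.1 i.2) ∧
      ∀ F T : Finset (Set X × Set X), ↑F ⊆ I → ↑T ⊆ I → Disjoint F T → (meet F T).Nonempty} (by
    intro c hc hchain
    rcases c.eq_empty_or_nonempty with rfl | hcne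
    · refine ⟨∅, ⟨by simp, fun F T hF hT _ ↦ ?_⟩, by simp⟩
      rw [subset_empty_iff, Finset.coe_eq_empty] at hF hT
      simpa [meet, hF, hT] using hKne
    · refine ⟨⋃₀ c, ⟨fun i ⟨I, hIc, hi⟩ ↦ (hc hIc).1 i hi, fun F T hF hT hd ↦ ?_⟩,
        fun I hI ↦ subset_sUnion_of_mem hI⟩
      obtain ⟨I, hIc, hFI⟩ := DirectedOn.exists_mem_subset_of_finset_subset_biUnion
        (f := id) hcne hchain.directedOn (s := F ∪ T) (by
          rw [Finset.coe_union]
          simpa [sUnion_eq_biUnion] using And.intro hF hT)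
      rw [Finset.coe_union] at hFI
      exact (hc hIc).2 F T (subset_union_left.trans hFI) (subset_union_right.trans hFI) hd)
  refine ⟨I, fun hcount ↦ ?_, fun i hi ↦ ?_, fun F T hF hT hd ↦ ?_⟩
  · obtain ⟨P, Q, hP, hQ, hPQ, hmeet⟩ := hsplit
      {B | ∃ F T : Finset (Set X × Set X), ↑F ⊆ I ∧ ↑T ⊆ I ∧ Disjoint F T ∧ B = meet F T} (by
        have hfin := countable_ofPred_finite_subset hcount
        refine ((((hfin.preimage Finset.coe_injective).prod
          (hfin.preimage Finset.coe_injective))).image fun q ↦ meet q.1 q.2).mono ?_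
        rintro _ ⟨F, T, hF, hT, -, rfl⟩
        exact ⟨(F, T), ⟨⟨F.finite_toSet, hF⟩, ⟨T.finite_toSet, hT⟩⟩, rfl⟩)
      ⟨_, ∅, ∅, by simp, by simp, by simp, rfl⟩ (by
        rintro _ ⟨F, T, hF, hT, hd, rfl⟩
        refine ⟨hK.inter (IsRegularGδ.inter ?_ ?_), hI.1.2 F T hF hT hd, inter_subset_left⟩
        · exact IsRegularGδ.biInter F.countable_toSet fun i hi ↦ (hI.1.1 i (hF hi)).1
        · exact IsRegularGδ.biInter T.countable_toSet fun i hi ↦ (hI.1.1 i (hT hi)).2.1)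
    have hnew : (P, Q) ∈ I := by
      refine hI.2 (y := insert (P, Q) I) ⟨?_, fun F T hF hT hd ↦ ?_⟩ (subset_insert _ _)
        (mem_insert _ _)
      · rintro i (rfl | hi)
        · exact ⟨hP, hQ, hPQ⟩
        · exact hI.1.1 i hi
      · have hF' : ↑(F.erase (P, Q)) ⊆ I := by
          rw [Finset.coe_erase]
          exact sdiff_singleton_subset_iff.2 hF
        have hT' : ↑(T.erase (P, Q)) ⊆ I := by
          rw [Finset.coe_erase]
          exact sdiff_singleton_subset_iff.2 hT
        have hd' : Disjoint (F.erase (P, Q)) (T.erase (P, Q)) :=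
          hd.mono (Finset.erase_subset _ _) (Finset.erase_subset _ _)
        have hm := hmeet _ ⟨_, _, hF', hT', hd', rfl⟩
        have hin : ∀ x ∈ meet (F.erase (P, Q)) (T.erase (P, Q)), ((P, Q) ∈ F → x ∈ P) →
            ((P, Q) ∈ T → x ∈ Q) → x ∈ meet F T := by
          rintro x ⟨hxK, hx1, hx2⟩ hxP hxQ
          refine ⟨hxK, mem_iInter₂.2 fun i hi ↦ ?_, mem_iInter₂.2 fun i hi ↦ ?_⟩
          · by_cases h : i = (P, Q)
            · subst h
              exact hxP hi
            · exact mem_iInter₂.1 hx1 i (by simpa [h] using hi)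
          · by_cases h : i = (P, Q)
            · subst h
              exact hxQ hi
            · exact mem_iInter₂.1 hx2 i (by simpa [h] using hi)
        by_cases h : (P, Q) ∈ F
        · obtain ⟨x, hx, hxP⟩ := hm.1
          exact ⟨x, hin x hx (fun _ ↦ hxP) fun h' ↦ absurd h' (Finset.disjoint_left.1 hd h)⟩
        · obtain ⟨x, hx, hxQ⟩ := hm.2
          exact ⟨x, hin x hx (fun h' ↦ absurd h' h) fun _ ↦ hxQ⟩
    obtain ⟨x, hx, hxP⟩ := (hmeet _ ⟨∅, {(P, Q)}, by simp, by simpa using hnew, by simp, rfl⟩).1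
    have hxQ : x ∈ Q := mem_iInter₂.1 hx.2.2 (P, Q) (by simp)
    exact disjoint_left.1 hPQ hxP hxQ
  · have := hI.1.1 i hi
    exact ⟨this.1.isClosed, this.2.1.isClosed, this.2.2⟩
  · obtain ⟨x, hx⟩ := hI.1.2 F T hF hT hd
    exact ⟨x, hx.2⟩

end PiCharacter

section NoCover

variable {X : Type*} [TopologicalSpace X]

theorem exists_disjoint_uncountable_subsets {ι : Type*} {J : Set ι} (hJ : ¬ J.Countable) :
    ∃ J₁ J₂ : Set ι, J₁ ⊆ J ∧ J₂ ⊆ J ∧ Disjoint J₁ J₂ ∧ ¬ J₁.Countable ∧ ¬ J₂.Countable := by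
  have hinf : ℵ₀ ≤ #J := by
    rw [← not_lt]
    exact fun h ↦ hJ (Cardinal.le_aleph0_iff_set_countable.1 h.le)
  obtain ⟨e⟩ : Nonempty (J ⊕ J ≃ J) := by
    rw [← Cardinal.eq, Cardinal.mk_sum, Cardinal.lift_id]
    exact Cardinal.add_eq_self hinf
  have hinl : Function.Injective fun j ↦ (e (Sum.inl j) : ι) :=
    Subtype.val_injective.comp (e.injective.comp Sum.inl_injective)
  have hinr : Function.Injective fun j ↦ (e (Sum.inr j) : ι) :=
    Subtype.val_injective.comp (e.injective.comp Sum.inr_injective)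
  have hcount : ∀ f : J → ι, Function.Injective f → ¬ (range f).Countable := fun f hf h ↦
    hJ (by
      have := h.preimage_of_injOn (f := f) hf.injOn
      rw [preimage_range, countable_univ_iff] at this
      exact this)
  refine ⟨_, _, ?_, ?_, ?_, hcount _ hinl, hcount _ hinr⟩
  · rintro _ ⟨j, rfl⟩
    exact (e _).2
  · rintro _ ⟨j, rfl⟩
    exact (e _).2
  · rw [disjoint_left]
    rintro _ ⟨j, rfl⟩ ⟨k, hk⟩
    exact Sum.inr_ne_inl (e.injective (Subtype.ext hk))

theorem exists_minimal_closed_meeting [CompactSpace X] {σ : Type*} [Nonempty σ] {P : σ → Set X}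
    (hP : ∀ s, IsClosed (P s)) {K : Set X} (hK : IsClosed K) (hKP : ∀ s, (K ∩ P s).Nonempty) :
    ∃ F ⊆ K, IsClosed F ∧ (∀ s, (F ∩ P s).Nonempty) ∧
      ∀ F' ⊆ F, IsClosed F' → (∀ s, (F' ∩ P s).Nonempty) → F' = F := by
  obtain ⟨F, hFK, hF⟩ := zorn_superset_nonempty
    {F : Set X | IsClosed F ∧ ∀ s, (F ∩ P s).Nonempty} (by
    intro c hc hchain hcne
    refine ⟨⋂₀ c, ⟨isClosed_sInter fun F hF ↦ (hc hF).1, fun s ↦ ?_⟩,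
      fun F hF ↦ sInter_subset_of_mem hF⟩
    have : Nonempty c := hcne.to_subtype
    have h := IsCompact.nonempty_iInter_of_directed_nonempty_isCompact_isClosed
      (fun F : c ↦ F.1 ∩ P s) (by
        rintro ⟨F, hF⟩ ⟨G, hG⟩
        rcases hchain.total hF hG with h | h
        · exact ⟨⟨F, hF⟩, subset_rfl, inter_subset_inter_left _ h⟩
        · exact ⟨⟨G, hG⟩, inter_subset_inter_left _ h, subset_rfl⟩)
      (fun F ↦ (hc F.2).2 s) (fun F ↦ ((hc F.2).1.inter (hP s)).isCompact)
      (fun F ↦ (hc F.2).1.inter (hP s))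
    rwa [← iInter_inter, ← sInter_eq_iInter] at h) K ⟨hK, hKP⟩
  refine ⟨F, hFK, hF.prop.1, hF.prop.2, fun F' hF' hcl hne ↦ ?_⟩
  exact hF'.antisymm (hF.2 ⟨hcl, hne⟩ hF')

theorem not_subset_biUnion_countablyTightIn [CompactSpace X] {ι κ : Type*}
    {R : ι → Bool → Set X} (hR : ∀ i b, IsClosed (R i b))
    (hd : ∀ i, Disjoint (R i true) (R i false)) {C : κ → Set X}
    (hC : ∀ k, CountablyTightIn (C k)) (t : Finset κ) (J : Set ι) (hJ : ¬ J.Countable)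
    (K : Set X) (hK : IsClosed K)
    (hne : ∀ s : ι → Bool, (K ∩ ⋂ i ∈ J, R i (s i)).Nonempty) : ¬ K ⊆ ⋃ k ∈ t, C k := by
  classical
  induction t using Finset.induction_on generalizing J K with
  | empty =>
    intro h
    obtain ⟨x, hx, -⟩ := hne fun _ ↦ true
    simpa using h hx
  | insert k t _ ih =>
    intro hcov
    have ih' : ∀ J : Set ι, ¬ J.Countable → ∀ L, IsClosed L → L ⊆ K →
        (∀ s : ι → Bool, (L ∩ ⋂ i ∈ J, R i (s i)).Nonempty) → (L ∩ C k).Nonempty := by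
      intro J hJ L hL hLK hne
      by_contra h
      refine ih J hJ L hL hne fun x hx ↦ ?_
      have h1 := hcov (hLK hx)
      rw [Finset.set_biUnion_insert] at h1
      rcases h1 with h1 | h1
      · exact absurd ⟨x, hx, h1⟩ h
      · exact h1
    obtain ⟨J₁, J₂, hJ₁, hJ₂, hJd, hJ₁c, hJ₂c⟩ := exists_disjoint_uncountable_subsets hJ
    have hP : ∀ s : ι → Bool, IsClosed (⋂ i ∈ J, R i (s i)) := fun s ↦
      isClosed_biInter fun i _ ↦ hR _ _
    obtain ⟨F, hFK, hF, hFne, hFmin⟩ := exists_minimal_closed_meeting hP hK hne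
    have hmem : ∀ (s : ι → Bool) (S : Set ι), S ⊆ J → ∀ s' : ι → Bool,
        ∃ x ∈ F, (∀ i ∈ S, x ∈ R i (s i)) ∧ ∀ i ∈ J, i ∉ S → x ∈ R i (s' i) := by
      intro s S hS s'
      obtain ⟨x, hxF, hx⟩ := hFne fun i ↦ if i ∈ S then s i else s' i
      refine ⟨x, hxF, fun i hi ↦ ?_, fun i hi hiS ↦ ?_⟩
      · simpa [hi] using mem_iInter₂.1 hx i (hS hi)
      · simpa [hiS] using mem_iInter₂.1 hx i hi
    obtain ⟨p, ⟨hpF, hpJ⟩, hpC⟩ := ih' J₂ hJ₂c (F ∩ ⋂ i ∈ J₁, R i true)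
      (hF.inter (isClosed_biInter fun i _ ↦ hR _ _)) (inter_subset_left.trans hFK) (by
        intro s
        obtain ⟨x, hxF, h1, h2⟩ := hmem (fun _ ↦ true) J₁ hJ₁ s
        exact ⟨x, ⟨hxF, mem_iInter₂.2 h1⟩,
          mem_iInter₂.2 fun i hi ↦ h2 i (hJ₂ hi) (disjoint_right.1 hJd hi)⟩)
    obtain ⟨B, hBA, hB, hpB⟩ := hC k {q ∈ C k | {i ∈ J₁ | q ∉ R i false}.Countable}
      (fun q hq ↦ hq.1) p hpC (by
      rw [mem_closure_iff]
      intro U hU hpU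
      have hs : ∃ s : ι → Bool, F ∩ Uᶜ ∩ ⋂ i ∈ J, R i (s i) = ∅ := by
        by_contra! h
        have := hFmin (F ∩ Uᶜ) inter_subset_left (hF.inter hU.isClosed_compl) h
        rw [← this] at hpF
        exact hpF.2 hpU
      obtain ⟨s, hs⟩ := hs
      obtain ⟨e, he⟩ := (hF.inter hU.isClosed_compl).isCompact.elim_finite_subfamily_closed
        (fun i : J ↦ R i (s i)) (fun i ↦ hR _ _)
        (by rwa [← biInter_eq_iInter J fun i _ ↦ R i (s i)])
      let E : Set ι := (↑) '' (e : Set J)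
      have hEfin : E.Finite := e.finite_toSet.image _
      have hEJ : E ⊆ J := by
        rintro _ ⟨i, -, rfl⟩
        exact i.2
      obtain ⟨q, ⟨⟨hqF, hqE⟩, hqJ⟩, hqC⟩ := ih' (J₂ \ E)
        (fun h ↦ hJ₂c ((h.union hEfin.countable).mono fun i hi ↦ by
          by_cases hiE : i ∈ E
          · exact Or.inr hiE
          · exact Or.inl ⟨hi, hiE⟩))
        (F ∩ (⋂ i ∈ E, R i (s i)) ∩ ⋂ i ∈ J₁ \ E, R i false)
        ((hF.inter (isClosed_biInter fun i _ ↦ hR _ _)).inter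
          (isClosed_biInter fun i _ ↦ hR _ _))
        (inter_subset_left.trans (inter_subset_left.trans hFK)) (by
          intro s'
          obtain ⟨x, hxF, h1, h2⟩ := hmem s E hEJ fun i ↦ if i ∈ J₁ then false else s' i
          refine ⟨x, ⟨⟨hxF, mem_iInter₂.2 h1⟩, mem_iInter₂.2 fun i hi ↦ ?_⟩,
            mem_iInter₂.2 fun i hi ↦ ?_⟩
          · simpa [hi.1] using h2 i (hJ₁ hi.1) hi.2
          · simpa [disjoint_right.1 hJd hi.1] using h2 i (hJ₂ hi.1) hi.2)
      refine ⟨q, ?_, hqC, hEfin.countable.mono fun i hi ↦ ?_⟩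
      · by_contra hqU
        have : q ∈ F ∩ Uᶜ ∩ ⋂ i ∈ e, R i (s i) :=
          ⟨⟨hqF, hqU⟩, mem_iInter₂.2 fun i hi ↦ mem_iInter₂.1 hqE i ⟨i, hi, rfl⟩⟩
        rw [he] at this
        exact this
      · by_contra hiE
        exact hi.2 (mem_iInter₂.1 hqJ i ⟨hi.1, hiE⟩))
    have hbad : (⋃ q ∈ B, {i ∈ J₁ | q ∉ R i false}).Countable := hB.biUnion fun q hq ↦ (hBA hq).2
    obtain ⟨i, hiJ, hi⟩ : ∃ i ∈ J₁, i ∉ ⋃ q ∈ B, {i ∈ J₁ | q ∉ R i false} := by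
      by_contra! h
      exact hJ₁c (hbad.mono h)
    have hBi : B ⊆ R i false := fun q hq ↦ by
      by_contra hqi
      exact hi (mem_iUnion₂.2 ⟨q, hq, hiJ, hqi⟩)
    exact disjoint_left.1 (hd i) (mem_iInter₂.1 hpJ i hiJ) (closure_minimal hBi (hR _ _) hpB)

theorem exists_hasCountablePiBaseAt [CompactSpace X] [T2Space X] [Nonempty X] {κ : Type*}
    [Fintype κ] {C : κ → Set X} (hC : ∀ k, CountablyTightIn (C k)) (hcov : ⋃ k, C k = Set.univ) :
    ∃ p : X, HasCountablePiBaseAt p := by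
  classical
  by_contra! h
  obtain ⟨I, hI, hcl, hind⟩ := exists_uncountable_independent_s12 h
  let R : I → Bool → Set X := fun i b ↦ if b then i.1.1 else i.1.2
  have hR : ∀ i b, IsClosed (R i b) := fun i b ↦ by
    cases b
    · exact (hcl i i.2).2.1
    · exact (hcl i i.2).1
  refine not_subset_biUnion_countablyTightIn hR (fun i ↦ (hcl i i.2).2.2) hC Finset.univ
    Set.univ (by rwa [countable_univ_iff]) Set.univ isClosed_univ (fun s ↦ ?_)
    (by simp [hcov])
  by_contra hemp
  rw [biInter_univ, not_nonempty_iff_eq_empty] at hemp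
  obtain ⟨u, hu⟩ := isCompact_univ.elim_finite_subfamily_closed _ (fun i ↦ hR i (s i)) hemp
  have hmap : ∀ v : Finset I, ((v.map (Function.Embedding.subtype _) :
      Finset (Set X × Set X)) : Set (Set X × Set X)) ⊆ I := by
    intro v i hi
    simp only [Finset.coe_map, Function.Embedding.subtype_apply, mem_image] at hi
    obtain ⟨j, -, rfl⟩ := hi
    exact j.2
  obtain ⟨x, hx1, hx2⟩ := hind
    ((u.filter fun i ↦ s i = true).map (Function.Embedding.subtype _))
    ((u.filter fun i ↦ ¬ s i = true).map (Function.Embedding.subtype _)) (hmap _) (hmap _)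
    ((Finset.disjoint_map _).2 (Finset.disjoint_filter_filter_not _ _ _))
  have : x ∈ Set.univ ∩ ⋂ i ∈ u, R i (s i) := by
    refine ⟨mem_univ _, mem_iInter₂.2 fun i hi ↦ ?_⟩
    by_cases hs : s i = true
    · simpa [R, hs] using mem_iInter₂.1 hx1 i (by simpa [hs] using hi)
    · simpa [R, hs] using mem_iInter₂.1 hx2 i (by simpa [hs] using hi)
  rw [hu] at this
  exact this

end NoCover

section Tightness

variable {X : Type*} [TopologicalSpace X]

theorem exists_countable_seqClosedUnder {X : Type*} (s : X → ℕ → X) {B : Set X}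
    (hB : B.Countable) : ∃ D, B ⊆ D ∧ D.Countable ∧ SeqClosedUnder s D := by
  let step : Set X → Set X := fun D ↦ ⋃ x ∈ D, range (s x)
  have hsucc : ∀ n, step^[n + 1] B = step (step^[n] B) := fun n ↦
    Function.iterate_succ_apply' _ _ _
  have hcount : ∀ n, (step^[n] B).Countable := by
    intro n
    induction n with
    | zero => exact hB
    | succ n ih =>
      rw [hsucc]
      exact ih.biUnion fun x _ ↦ countable_range _
  refine ⟨⋃ n, step^[n] B, subset_iUnion (fun n ↦ step^[n] B) 0, countable_iUnion hcount,
    fun x hx n ↦ ?_⟩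
  obtain ⟨k, hk⟩ := mem_iUnion.1 hx
  refine mem_iUnion.2 ⟨k + 1, ?_⟩
  rw [hsucc]
  exact mem_iUnion₂.2 ⟨x, hk, n, rfl⟩

theorem HasCountablePiBaseAt.exists_countable_subset {x : X} (hx : HasCountablePiBaseAt x)
    {U C : Set X} (hU : IsOpen U) (hxU : x ∈ U) (hUC : U ⊆ closure C) :
    ∃ B ⊆ C, B.Countable ∧ x ∈ closure B := by
  classical
  obtain ⟨V, hV, hVx⟩ := hx
  refine ⟨C ∩ range fun n ↦ if h : (V n ∩ C).Nonempty then h.choose else x, inter_subset_left,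
    (countable_range _).mono inter_subset_right, ?_⟩
  rw [mem_closure_iff]
  intro W hW hxW
  obtain ⟨n, hn⟩ := hVx (W ∩ U) (hW.inter hU) ⟨hxW, hxU⟩
  obtain ⟨y, hy⟩ := (hV n).2
  have h : (V n ∩ C).Nonempty := mem_closure_iff.1 (hUC (hn hy).2) (V n) (hV n).1 hy
  exact ⟨h.choose, (hn h.choose_spec.1).1, h.choose_spec.2, n, by simp [h]⟩

theorem exists_tightFor {κ : Type*} [Countable κ] {U C : κ → Set X} (hU : ∀ k, IsOpen (U k))
    (hC : ∀ k, CountablyTightIn (C k)) (hUC : ∀ k, U k ⊆ closure (C k))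
    (hcov : ∀ x, ∃ k, x ∈ U k ∩ C k) (hpi : ∀ x : X, HasCountablePiBaseAt x) :
    ∃ s : X → ℕ → X, TightFor s := by
  have h1 : ∀ k x, ∃ B ⊆ C k, B.Countable ∧ (x ∈ U k → x ∈ closure B) := by
    intro k x
    by_cases hx : x ∈ U k
    · obtain ⟨B, hBC, hB, hxB⟩ := (hpi x).exists_countable_subset (hU k) hx (hUC k)
      exact ⟨B, hBC, hB, fun _ ↦ hxB⟩
    · exact ⟨∅, empty_subset _, countable_empty, fun h ↦ absurd h hx⟩
  choose B hBC hB hxB using h1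
  have h2 : ∀ x, ∃ f : ℕ → X, insert x (⋃ k, B k x) = range f := fun x ↦
    ((countable_iUnion fun k ↦ hB k x).insert x).exists_eq_range (insert_nonempty _ _)
  choose s hs using h2
  refine ⟨s, fun D hD x hx ↦ ?_⟩
  obtain ⟨k, hxU, hxC⟩ := hcov x
  have hxD : x ∈ closure (D ∩ C k) := by
    have h3 : x ∈ closure (U k ∩ D) := by
      rw [mem_closure_iff] at hx ⊢
      intro W hW hxW
      obtain ⟨y, hy, hyD⟩ := hx _ (hW.inter (hU k)) ⟨hxW, hxU⟩
      exact ⟨y, hy.1, hy.2, hyD⟩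
    refine closure_minimal ?_ isClosed_closure h3
    rintro a ⟨haU, haD⟩
    refine closure_mono ?_ (hxB k a haU)
    refine subset_inter (fun b hb ↦ ?_) (hBC k a)
    have : b ∈ range (s a) := by
      rw [← hs]
      exact Or.inr (mem_iUnion.2 ⟨k, hb⟩)
    obtain ⟨n, rfl⟩ := this
    exact hD a haD n
  obtain ⟨E, hE, hEc, hxE⟩ := hC k (D ∩ C k) inter_subset_right x hxC hxD
  exact ⟨E, hE.trans inter_subset_left, hEc, hxE⟩

theorem exists_chain_countably_bounded {T : Type*} {r : T → T → Prop}
    (htrans : ∀ a b c, r a b → r b c → r a c)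
    (hbound : ∀ c : Set T, c.Countable → IsChain r c → ∃ t, ∀ x ∈ c, r x t) :
    ∃ L : Set T, IsChain r L ∧ ∀ c ⊆ L, c.Countable → ∃ t ∈ L, ∀ x ∈ c, r x t := by
  have hmax : IsMaxChain r (maxChain r) := maxChain_spec
  refine ⟨maxChain r, hmax.1, fun c hcL hc ↦ ?_⟩
  obtain ⟨t, ht⟩ := hbound c hc (hmax.1.mono hcL)
  by_contra! h
  have hlt : ∀ l ∈ maxChain r, r l t := by
    intro l hl
    obtain ⟨x, hx, hxl⟩ := h l hl
    rcases eq_or_ne x l with rfl | hne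
    · exact ht x hx
    · rcases hmax.1 (hcL hx) hl hne with h1 | h1
      · exact absurd h1 hxl
      · exact htrans _ _ _ h1 (ht x hx)
  have heq := hmax.2 (hmax.1.insert fun b hb _ ↦ Or.inr (hlt b hb)) (subset_insert t _)
  have htL : t ∈ maxChain r := by
    rw [heq]
    exact mem_insert _ _
  obtain ⟨x, hx, hxt⟩ := h t htL
  exact hxt (ht x hx)

theorem nonempty_inter_biInter_of_nested [CompactSpace X] {T : Type*} {L : Set T}
    {K : T → Set X} (hK : ∀ a ∈ L, IsClosed (K a))
    (hL : ∀ a ∈ L, ∀ b ∈ L, K a ⊆ K b ∨ K b ⊆ K a) {E : Set X} (hE : IsClosed E)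
    (hEne : E.Nonempty) (h : ∀ a ∈ L, (E ∩ K a).Nonempty) : (E ∩ ⋂ a ∈ L, K a).Nonempty := by
  rcases L.eq_empty_or_nonempty with rfl | hLne
  · simpa using hEne
  have : Nonempty L := hLne.to_subtype
  have h1 := IsCompact.nonempty_iInter_of_directed_nonempty_isCompact_isClosed
    (fun a : L ↦ E ∩ K a) (by
      rintro ⟨a, ha⟩ ⟨b, hb⟩
      rcases hL a ha b hb with h | h
      · exact ⟨⟨a, ha⟩, subset_rfl, inter_subset_inter_right _ h⟩
      · exact ⟨⟨b, hb⟩, inter_subset_inter_right _ h, subset_rfl⟩)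
    (fun a ↦ h a a.2) (fun a ↦ (hE.inter (hK a a.2)).isCompact) (fun a ↦ hE.inter (hK a a.2))
  rwa [← inter_iInter, ← biInter_eq_iInter L fun a _ ↦ K a] at h1

theorem TightFor.exists_subseparable [CompactSpace X] [T2Space X] [Nonempty X] {s : X → ℕ → X}
    (hs : TightFor s) :
    ∃ G S : Set X, IsRegularGδ G ∧ G.Nonempty ∧ S.Countable ∧ G ⊆ closure S := by
  by_contra! hno
  let T := {q : Set X × Set X // q.1.Countable ∧ SeqClosedUnder s q.1 ∧ IsRegularGδ q.2 ∧
    (q.1 ∩ q.2).Nonempty}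
  let r : T → T → Prop := fun a b ↦ a.1.1 ⊆ b.1.1 ∧ b.1.2 ⊆ a.1.2 ∧ Disjoint b.1.2 (closure a.1.1)
  have hnest : ∀ L : Set T, IsChain r L → ∀ a ∈ L, ∀ b ∈ L, a.1.2 ⊆ b.1.2 ∨ b.1.2 ⊆ a.1.2 := by
    intro L hL a ha b hb
    rcases eq_or_ne a b with rfl | hne
    · exact Or.inl subset_rfl
    · exact (hL ha hb hne).symm.imp (fun h ↦ h.2.1) fun h ↦ h.2.1
  obtain ⟨L, hL, hLb⟩ := exists_chain_countably_bounded (r := r)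
    (fun a b c hab hbc ↦ ⟨hab.1.trans hbc.1, hbc.2.1.trans hab.2.1, hab.2.2.mono_left hbc.2.1⟩) (by
    intro c hc hchain
    have hK : IsRegularGδ (⋂ a ∈ c, a.1.2) := IsRegularGδ.biInter hc fun a _ ↦ a.2.2.2.1
    have hKne : (⋂ a ∈ c, a.1.2).Nonempty := by
      have := nonempty_inter_biInter_of_nested (K := fun a : T ↦ a.1.2)
        (fun a _ ↦ a.2.2.2.1.isClosed) (hnest c hchain) isClosed_univ univ_nonempty
        (fun a _ ↦ by simpa using a.2.2.2.2.mono inter_subset_right)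
      simpa using this
    have hD : (⋃ a ∈ c, a.1.1).Countable := hc.biUnion fun a _ ↦ a.2.1
    obtain ⟨x, hxK, hxD⟩ := not_subset.1 (hno _ _ hK hKne hD)
    obtain ⟨G, hG, hxG, hGD⟩ := exists_isRegularGδ_subset
      (isClosed_closure (s := ⋃ a ∈ c, a.1.1)).isOpen_compl hxD
    obtain ⟨D, hsub, hDc, hDs⟩ := exists_countable_seqClosedUnder s (hD.insert x)
    refine ⟨⟨(D, (⋂ a ∈ c, a.1.2) ∩ G), hDc, hDs, hK.inter hG, x, hsub (mem_insert _ _), hxK, hxG⟩,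
      fun a ha ↦ ⟨?_, ?_, ?_⟩⟩
    · exact (subset_biUnion_of_mem (u := fun a : T ↦ a.1.1) ha).trans
        ((subset_insert _ _).trans hsub)
    · exact inter_subset_left.trans (biInter_subset_of_mem ha)
    · rw [disjoint_left]
      intro y hy hya
      exact hGD hy.2 (closure_mono (subset_biUnion_of_mem (u := fun a : T ↦ a.1.1) ha) hya))
  let D : Set X := ⋃ a ∈ L, a.1.1
  have hDs : SeqClosedUnder s D := by
    intro x hx n
    obtain ⟨a, ha, hxa⟩ := mem_iUnion₂.1 hx
    exact mem_iUnion₂.2 ⟨a, ha, a.2.2.1 x hxa n⟩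
  have hLD : ∀ a ∈ L, (closure D ∩ a.1.2).Nonempty := fun a ha ↦ by
    obtain ⟨x, hx, hxK⟩ := a.2.2.2.2
    exact ⟨x, subset_closure (mem_iUnion₂.2 ⟨a, ha, hx⟩), hxK⟩
  obtain ⟨l, hl, -⟩ := hLb ∅ (empty_subset _) countable_empty
  obtain ⟨y, hyD, hyK⟩ := nonempty_inter_biInter_of_nested (K := fun a : T ↦ a.1.2)
    (fun a _ ↦ a.2.2.2.1.isClosed) (hnest L hL) (isClosed_closure (s := D))
    ((hLD l hl).mono inter_subset_left) hLD
  obtain ⟨B, hBD, hB, hyB⟩ := hs D hDs y hyD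
  have hsel : ∀ b : B, ∃ a ∈ L, (b : X) ∈ a.1.1 := fun b ↦ by
    obtain ⟨a, ha, hba⟩ := mem_iUnion₂.1 (hBD b.2)
    exact ⟨a, ha, hba⟩
  choose g hgL hg using hsel
  have := hB.to_subtype
  obtain ⟨t, ht, hgt⟩ := hLb (range g) (range_subset_iff.2 hgL) (countable_range g)
  obtain ⟨t', ht', htt'⟩ := hLb {t} (singleton_subset_iff.2 ht) (countable_singleton t)
  have hBt : B ⊆ t.1.1 := fun b hb ↦ (hgt _ ⟨⟨b, hb⟩, rfl⟩).1 (hg ⟨b, hb⟩)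
  exact disjoint_left.1 (htt' t rfl).2.2 (mem_iInter₂.1 hyK t' ht') (closure_mono hBt hyB)

end Tightness

section Density

theorem exists_closed_under_countable_operations_s12 {X : Type u} {A : Type} (hA : #A ≤ continuum)
    (x₀ : X) (Φ : A → (ℕ → X) → X) :
    ∃ D : Set X, x₀ ∈ D ∧ #D ≤ continuum ∧ ∀ a f, (∀ n, f n ∈ D) → Φ a f ∈ D := by
  let β : Option A → Type := fun o ↦ o.elim PEmpty fun _ ↦ ℕ
  let ev : WType β → X := WType.elim X fun q ↦
    match q with
    | ⟨none, _⟩ => x₀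
    | ⟨some a, f⟩ => Φ a f
  have hW : #(WType β) ≤ continuum := by
    refine WType.cardinalMk_le_of_le ?_
    refine (Cardinal.sum_le_sum _ (fun _ ↦ continuum) fun o ↦ ?_).trans ?_
    · cases o with
      | none => simpa [β] using Cardinal.nat_lt_continuum 1 |>.le
      | some a => simp [β]
    · rw [Cardinal.sum_const', Cardinal.mk_option]
      calc (#A + 1) * continuum ≤ (continuum + continuum) * continuum :=
            mul_le_mul' (add_le_add hA (Cardinal.nat_lt_continuum 1 |>.le.trans_eq' (by simp)))
              le_rfl
        _ = continuum := by simp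
  refine ⟨range ev, ⟨WType.mk none PEmpty.elim, rfl⟩, ?_, fun a f hf ↦ ?_⟩
  · have h := Cardinal.mk_range_le_lift (f := ev)
    simpa using h.trans (Cardinal.lift_le.{u}.2 hW)
  · choose g hg using hf
    refine ⟨WType.mk (some a) g, ?_⟩
    have : f = fun n ↦ ev (g n) := funext fun n ↦ (hg n).symm
    rw [this]
    rfl

variable {X : Type*} [TopologicalSpace X]

theorem inter_closure_eq_of_trace {V V' : ℕ → Set X} (hV : ∀ n, IsOpen (V n)) {G G' B : Set X}
    (hGV : ∀ n, G ⊆ V n) (hVG' : ⋂ n, closure (V' n) ⊆ G')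
    (h : ∀ n, V n ∩ B = V' n ∩ B) : G ∩ closure B ⊆ G' := by
  rintro x ⟨hxG, hxB⟩
  refine hVG' (mem_iInter.2 fun n ↦ ?_)
  have := (hV n).inter_closure ⟨hGV n hxG, hxB⟩
  rw [h] at this
  exact closure_mono inter_subset_left this

/-- A form of Pytkeev's theorem on covers by Gδ-sets. -/
theorem TightFor.exists_subcover_le_continuum [CompactSpace X] [Nonempty X] {s : X → ℕ → X}
    (hs : TightFor s) {G : X → Set X} (hG : ∀ x, IsRegularGδ (G x)) (hxG : ∀ x, x ∈ G x) :
    ∃ D : Set X, #D ≤ continuum ∧ ⋃ x ∈ D, G x = Set.univ := by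
  classical
  choose V hV hGV hVG using hG
  obtain ⟨x₀⟩ := ‹Nonempty X›
  let code : (ℕ → X) → X → ℕ → Set ℕ := fun f y n ↦ {m | f m ∈ V y n}
  let τ : (ℕ → Set ℕ) → (ℕ → X) → X := fun a f ↦
    if h : ∃ y, code f y = a then h.choose else x₀
  let w : Finset (ℕ × ℕ) → (ℕ → X) → X := fun e f ↦
    if h : ∃ q, ∀ i ∈ e, q ∉ V (f i.1) i.2 then h.choose else x₀
  let Φ : (ℕ → Set ℕ) ⊕ ℕ ⊕ Finset (ℕ × ℕ) → (ℕ → X) → X :=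
    Sum.elim τ (Sum.elim (fun n f ↦ s (f 0) n) w)
  obtain ⟨D, hx₀, hDc, hD⟩ := exists_closed_under_countable_operations_s12 (by
    simp) x₀ Φ
  refine ⟨D, hDc, eq_univ_of_forall fun q ↦ ?_⟩
  by_contra hq
  have hn : ∀ d ∈ D, ∃ n, q ∉ V d n := by
    intro d hd
    by_contra! h
    exact hq (mem_iUnion₂.2 ⟨d, hd, hVG d (mem_iInter.2 fun n ↦ subset_closure (h n))⟩)
  choose! N hN using hn
  have hcov : closure D ⊆ ⋃ d : D, V d (N d) := by
    intro x hx
    obtain ⟨B, hBD, hB, hxB⟩ := hs D (fun x hx n ↦ hD (Sum.inr (Sum.inl n)) (fun _ ↦ x) fun _ ↦ hx)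
      x hx
    obtain ⟨f, rfl⟩ := hB.exists_eq_range (closure_nonempty_iff.1 ⟨x, hxB⟩)
    have hfD : ∀ n, f n ∈ D := fun n ↦ hBD ⟨n, rfl⟩
    have hex : ∃ y, code f y = code f x := ⟨x, rfl⟩
    let y := τ (code f x) f
    have hyD : y ∈ D := hD (Sum.inl (code f x)) f hfD
    have hy : code f y = code f x := by
      simp only [y, τ, dif_pos hex]
      exact hex.choose_spec
    refine mem_iUnion.2 ⟨⟨y, hyD⟩, hGV y _ ?_⟩
    refine inter_closure_eq_of_trace (hV x) (hGV x) (hVG y) (fun n ↦ ?_) ⟨hxG x, hxB⟩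
    ext z
    simp only [mem_inter_iff, mem_range]
    refine and_congr_left ?_
    rintro ⟨m, rfl⟩
    exact (Set.ext_iff.1 (congrFun hy n) m).symm
  obtain ⟨t, ht⟩ := isClosed_closure.isCompact.elim_finite_subcover _ (fun d : D ↦ hV d (N d)) hcov
  have hrange : ∃ f : ℕ → X, insert x₀ ((↑) '' (t : Set D)) = range f :=
    ((t.countable_toSet.image _).insert x₀).exists_eq_range (insert_nonempty _ _)
  obtain ⟨f, hf⟩ := hrange
  have hfD : ∀ n, f n ∈ D := fun n ↦ by
    have : f n ∈ insert x₀ ((↑) '' (t : Set D)) := hf ▸ mem_range_self n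
    rcases this with h | ⟨d, -, h⟩
    · rw [h]
      exact hx₀
    · rw [← h]
      exact d.2
  have hidx : ∀ d : D, ∃ i, d ∈ t → f i = d := fun d ↦ by
    by_cases hd : d ∈ t
    · have : (d : X) ∈ range f := hf ▸ Or.inr ⟨d, hd, rfl⟩
      obtain ⟨i, hi⟩ := this
      exact ⟨i, fun _ ↦ hi⟩
    · exact ⟨0, fun h ↦ absurd h hd⟩
  choose idx hidx using hidx
  let e : Finset (ℕ × ℕ) := t.image fun d ↦ (idx d, N d)
  have hex : ∃ q, ∀ i ∈ e, q ∉ V (f i.1) i.2 := by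
    refine ⟨q, fun i hi ↦ ?_⟩
    obtain ⟨d, hd, rfl⟩ := Finset.mem_image.1 hi
    simp only [hidx d hd]
    exact hN d d.2
  have hwD : w e f ∈ D := hD (Sum.inr (Sum.inr e)) f hfD
  have hw : ∀ i ∈ e, w e f ∉ V (f i.1) i.2 := by
    simp only [w, dif_pos hex]
    exact hex.choose_spec
  obtain ⟨d, hd, hwd⟩ := mem_iUnion₂.1 (ht (subset_closure hwD))
  have := hw (idx d, N d) (Finset.mem_image.2 ⟨d, hd, rfl⟩)
  simp only [hidx d hd] at this
  exact this hwd

theorem mk_le_continuum_of_dense [T2Space X] (hhom : ∀ x y : X, ∃ h : X ≃ₜ X, h x = y) {p : X}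
    (hp : HasCountablePiBaseAt p) {D : Set X} (hD : Dense D) (hDc : #D ≤ continuum) :
    #X ≤ continuum := by
  obtain ⟨U, hU, hUp⟩ := hp
  choose h hh using hhom p
  have hne : ∀ x n, ∃ d : D, (d : X) ∈ h x '' U n := fun x n ↦ by
    obtain ⟨d, hd, hdD⟩ := hD.inter_open_nonempty _ ((h x).isOpenMap _ (hU n).1)
      ((hU n).2.image _)
    exact ⟨⟨d, hdD⟩, hd⟩
  choose φ hφ using hne
  have hinj : Function.Injective φ := by
    intro x y hxy
    by_contra hne
    obtain ⟨W, W', hW, hW', hxW, hyW', hd⟩ := t2_separation hne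
    obtain ⟨n, hn⟩ := hUp (h x ⁻¹' W ∩ h y ⁻¹' W')
      ((hW.preimage (h x).continuous).inter (hW'.preimage (h y).continuous))
      ⟨by rwa [mem_preimage, hh], by rwa [mem_preimage, hh]⟩
    have h1 : (φ x n : X) ∈ W := by
      obtain ⟨u, hu, hux⟩ := hφ x n
      rw [← hux]
      exact (hn hu).1
    have h2 : (φ y n : X) ∈ W' := by
      obtain ⟨u, hu, hux⟩ := hφ y n
      rw [← hux]
      exact (hn hu).2
    rw [hxy] at h1
    exact disjoint_left.1 hd h1 h2
  refine (Cardinal.mk_le_of_injective hinj).trans ?_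
  have h1 : #(ℕ → D) = #D ^ ℵ₀ := by simp
  rw [h1]
  exact (Cardinal.power_le_power_right hDc).trans (by simp)

end Density

section Homogeneous

variable {X : Type u} [TopologicalSpace X]

theorem continuum_le_mk_of_no_isolated_points [CompactSpace X] [T2Space X] [Nonempty X]
    (hX : ∀ x : X, ¬ IsOpen {x}) : continuum ≤ #X := by
  have hsplit : ∀ U : Set X, IsOpen U → U.Nonempty → ∃ W : Bool → Set X,
      (∀ b, IsOpen (W b) ∧ (W b).Nonempty ∧ closure (W b) ⊆ U) ∧
        Disjoint (W true) (W false) := by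
    rintro U hU ⟨x, hx⟩
    obtain ⟨y, hyU, hyx⟩ : ∃ y ∈ U, y ≠ x := by
      by_contra! h
      exact hX x (by rwa [← (eq_singleton_iff_unique_mem.2 ⟨hx, h⟩ : U = {x})])
    obtain ⟨V, V', hV, hV', hxV, hyV', hd⟩ := t2_separation hyx.symm
    have hsub : ∀ z ∈ U, ∀ V : Set X, IsOpen V → z ∈ V →
        ∃ W, IsOpen W ∧ z ∈ W ∧ closure W ⊆ U ∧ W ⊆ V := by
      intro z hz V hV hzV
      obtain ⟨W, hW, hzW, hWU⟩ := normal_exists_closure_subset (isClosed_singleton (x := z))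
        (hU.inter hV) (singleton_subset_iff.2 ⟨hz, hzV⟩)
      exact ⟨W, hW, hzW rfl, hWU.trans inter_subset_left,
        subset_closure.trans (hWU.trans inter_subset_right)⟩
    obtain ⟨W, hW, hxW, hWU, hWV⟩ := hsub x hx V hV hxV
    obtain ⟨W', hW', hyW', hWU', hWV'⟩ := hsub y hyU V' hV' hyV'
    refine ⟨fun b ↦ if b then W else W', fun b ↦ ?_, hd.mono hWV hWV'⟩
    cases b
    · exact ⟨hW', ⟨y, hyW'⟩, hWU'⟩
    · exact ⟨hW, ⟨x, hxW⟩, hWU⟩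
  choose! child hchild hdisj using hsplit
  let A : List Bool → Set X := fun l ↦ List.rec Set.univ (fun b _ S ↦ child S b) l
  have hA : ∀ l, IsOpen (A l) ∧ (A l).Nonempty := by
    intro l
    induction l with
    | nil => exact ⟨isOpen_univ, univ_nonempty⟩
    | cons b l ih => exact ⟨(hchild _ ih.1 ih.2 b).1, (hchild _ ih.1 ih.2 b).2.1⟩
  have hAcl : CantorScheme.ClosureAntitone A := fun l b ↦ (hchild _ (hA l).1 (hA l).2 b).2.2
  have hAd : CantorScheme.Disjoint A := by
    intro l a b hab
    have := hdisj _ (hA l).1 (hA l).2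
    cases a <;> cases b
    · exact absurd rfl hab
    · exact this.symm
    · exact this
    · exact absurd rfl hab
  have hdom : ∀ x : ℕ → Bool, x ∈ (CantorScheme.inducedMap A).1 := by
    intro x
    obtain ⟨p, hp⟩ := IsCompact.nonempty_iInter_of_sequence_nonempty_isCompact_isClosed
      (fun n ↦ closure (A (PiNat.res x n)))
      (fun n ↦ closure_mono (hAcl.antitone (PiNat.res x n) (x n)))
      (fun n ↦ (hA _).2.closure) isClosed_closure.isCompact fun n ↦ isClosed_closure
    exact ⟨p, mem_iInter.2 fun n ↦ hAcl (PiNat.res x n) (x n) (mem_iInter.1 hp (n + 1))⟩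
  have hinj : Function.Injective fun x : ℕ → Bool ↦ (CantorScheme.inducedMap A).2 ⟨x, hdom x⟩ :=
    fun x y h ↦ congrArg Subtype.val (hAd.map_injective h)
  have := Cardinal.mk_le_of_injective (hinj.comp (ULift.down_injective : Function.Injective
    (ULift.down : ULift.{u} (ℕ → Bool) → ℕ → Bool)))
  simpa using this

theorem HasCountablePiBaseAt.image {p : X} (hp : HasCountablePiBaseAt p) (h : X ≃ₜ X) :
    HasCountablePiBaseAt (h p) := by
  obtain ⟨U, hU, hUp⟩ := hp
  refine ⟨fun n ↦ h '' U n, fun n ↦ ⟨h.isOpenMap _ (hU n).1, (hU n).2.image _⟩, fun W hW hpW ↦ ?_⟩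
  obtain ⟨n, hn⟩ := hUp (h ⁻¹' W) (hW.preimage h.continuous) hpW
  exact ⟨n, image_subset_iff.2 hn⟩

theorem exists_open_subset_closure_of_subset_biUnion {κ : Type*} (C : κ → Set X) (t : Finset κ)
    {U : Set X} (hU : IsOpen U) (hne : U.Nonempty) (hcov : U ⊆ ⋃ k ∈ t, C k) :
    ∃ V : Set X, ∃ t' : Finset κ, IsOpen V ∧ V.Nonempty ∧ V ⊆ ⋃ k ∈ t', C k ∧
      ∀ k ∈ t', V ⊆ closure (C k) := by
  classical
  induction t using Finset.strongInduction generalizing U with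
  | H t ih =>
    by_cases h : ∀ k ∈ t, U ⊆ closure (C k)
    · exact ⟨U, t, hU, hne, hcov, h⟩
    push Not at h
    obtain ⟨k, hk, hUk⟩ := h
    obtain ⟨x, hxU, hxk⟩ := not_subset.1 hUk
    refine ih (t.erase k) (Finset.erase_ssubset hk)
      (hU.inter (isClosed_closure (s := C k)).isOpen_compl) ⟨x, hxU, hxk⟩ ?_
    rintro y ⟨hyU, hyk⟩
    obtain ⟨j, hj, hyj⟩ := mem_iUnion₂.1 (hcov hyU)
    refine mem_iUnion₂.2 ⟨j, Finset.mem_erase.2 ⟨?_, hj⟩, hyj⟩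
    rintro rfl
    exact hyk (subset_closure hyj)

theorem exists_tightFor_of_homogeneous [CompactSpace X] [Nonempty X]
    (hhom : ∀ x y : X, ∃ h : X ≃ₜ X, h x = y) (hpi : ∀ x : X, HasCountablePiBaseAt x)
    {κ : Type*} [Fintype κ] {C : κ → Set X} (hC : ∀ k, CountablyTightIn (C k))
    (hcov : ⋃ k, C k = Set.univ) : ∃ s : X → ℕ → X, TightFor s := by
  obtain ⟨V, t, hV, ⟨p, hp⟩, hVt, hVC⟩ := exists_open_subset_closure_of_subset_biUnion C
    Finset.univ isOpen_univ univ_nonempty (by simp [hcov])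
  choose h hh using hhom p
  obtain ⟨F, hF⟩ := isCompact_univ.elim_finite_subcover (fun x ↦ h x '' V)
    (fun x ↦ (h x).isOpenMap _ hV) fun x _ ↦ mem_iUnion.2 ⟨x, p, hp, hh x⟩
  refine exists_tightFor (κ := F × t) (U := fun k ↦ h k.1 '' V) (C := fun k ↦ h k.1 '' C k.2)
    (fun k ↦ (h k.1).isOpenMap _ hV) (fun k ↦ (hC _).image _) (fun k ↦ ?_) (fun x ↦ ?_) hpi
  · rw [← (h k.1).image_closure]
    exact image_mono (hVC k.2 k.2.2)
  · obtain ⟨y, hy, v, hv, hvx⟩ := mem_iUnion₂.1 (hF (mem_univ x))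
    obtain ⟨k, hk, hvk⟩ := mem_iUnion₂.1 (hVt hv)
    exact ⟨⟨⟨y, hy⟩, ⟨k, hk⟩⟩, ⟨v, hv, hvx⟩, ⟨v, hvk, hvx⟩⟩

theorem TightFor.exists_dense_le_continuum [CompactSpace X] [T2Space X] [Nonempty X]
    (hhom : ∀ x y : X, ∃ h : X ≃ₜ X, h x = y) {s : X → ℕ → X} (hs : TightFor s) :
    ∃ D : Set X, Dense D ∧ #D ≤ continuum := by
  obtain ⟨G, S, hG, ⟨p, hp⟩, hS, hGS⟩ := hs.exists_subseparable
  choose h hh using hhom p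
  obtain ⟨D, hDc, hD⟩ := hs.exists_subcover_le_continuum (fun x ↦ hG.image (h x))
    fun x ↦ ⟨p, hp, hh x⟩
  refine ⟨⋃ x ∈ D, h x '' S, fun x ↦ ?_, ?_⟩
  · have hx : x ∈ ⋃ y ∈ D, h y '' G := hD ▸ mem_univ x
    obtain ⟨y, hy, hxy⟩ := mem_iUnion₂.1 hx
    have h1 : x ∈ closure (h y '' S) := by
      rw [← (h y).image_closure]
      exact image_mono hGS hxy
    exact closure_mono (subset_biUnion_of_mem (u := fun y ↦ h y '' S) hy) h1
  · refine (Cardinal.mk_biUnion_le _ _).trans ?_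
    refine (mul_le_mul' hDc (ciSup_le' fun x ↦ ?_)).trans Cardinal.continuum_mul_self.le
    exact ((hS.image _).le_aleph0).trans Cardinal.aleph0_le_continuum

end Homogeneous

theorem stmt_12 {X : Type u} [TopologicalSpace X] [CompactSpace X] [T2Space X]
    [Infinite X]
    (hhom : ∀ x y : X, ∃ h : X ≃ₜ X, h x = y)
    (n : ℕ) (A : Fin n → Set X) (hct : ∀ i, CountablyTight ↥(A i))
    (hcover : ⋃ i, A i = Set.univ) :
    #X = continuum := by
  have hA := fun i ↦ (hct i).countablyTightIn
  refine le_antisymm ?_ (continuum_le_mk_of_no_isolated_points fun x hx ↦ ?_)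
  · obtain ⟨p, hp⟩ := exists_hasCountablePiBaseAt hA hcover
    have hpi : ∀ x : X, HasCountablePiBaseAt x := fun x ↦ by
      obtain ⟨h, rfl⟩ := hhom p x
      exact hp.image h
    obtain ⟨s, hs⟩ := exists_tightFor_of_homogeneous hhom hpi hA hcover
    obtain ⟨D, hD, hDc⟩ := hs.exists_dense_le_continuum hhom
    exact mk_le_continuum_of_dense hhom hp hD hDc
  · have : DiscreteTopology X := discreteTopology_iff_isOpen_singleton.2 fun y ↦ by
      obtain ⟨h, rfl⟩ := hhom x y
      simpa using h.isOpenMap _ hx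
    exact not_finite_iff_infinite.2 ‹Infinite X› finite_of_compact_of_discrete
end
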